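/- arXiv:2302.02673 — 2 statements merged into one kernel-verified Lean document; each statement's English description precedes it below -/
import Mathlib

section
/- Let μ > 0 and for each integer N ≥ 1 set ℏ = ℏ_N := μ/N. Then for every g ∈ C_c^∞(ℝ), lim_{N→∞} ∬_{ℝ²} [σ_{P_{<N}}^{ℏ_N}(x,p) − χ_D^{(N)}(x,p)] · ℏ_N^{−2/3} g((x² + p² − 2μ)/ℏ_N^{2/3}) dx dp = 0. -/
open MeasureTheory Filter

/-- Physicists' Hermite polynomial `h_k(y) = (-1)^k e^{y^2} (d/dy)^k e^{-y^2}`. -/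
noncomputable def hermiteH (k : ℕ) (y : ℝ) : ℝ :=
  (-1)^k * Real.exp (y^2) * iteratedDeriv k (fun t => Real.exp (-t^2)) y

/-- Hermite function `ψ_k^ℏ`. -/
noncomputable def psiH (hbar : ℝ) (k : ℕ) (x : ℝ) : ℝ :=
  (Real.sqrt (Real.sqrt Real.pi * 2^k * (Nat.factorial k) * Real.sqrt hbar))⁻¹ *
    Real.exp (-x^2 / (2*hbar)) * hermiteH k (x / Real.sqrt hbar)

/-- Kernel of the spectral projection `P_{<N}`. -/
noncomputable def KerK (hbar : ℝ) (N : ℕ) (u v : ℝ) : ℝ :=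
  ∑ k ∈ Finset.range N, psiH hbar k u * psiH hbar k v

/-- Kernel of the Zeno Hamiltonian `H_N = P_{<N} p̂ P_{<N}`. -/
noncomputable def KerQ (hbar : ℝ) (N : ℕ) (u v : ℝ) : ℂ :=
  Complex.I * (Real.sqrt (hbar/2) : ℂ) *
    ∑ j ∈ Finset.range (N-1), ((Real.sqrt ((j:ℝ)+1) : ℝ) : ℂ) *
      ((psiH hbar (j+1) u * psiH hbar j v - psiH hbar j u * psiH hbar (j+1) v : ℝ) : ℂ)

/-- Weyl symbol of `P_{<N}`. -/
noncomputable def sigmaP (hbar : ℝ) (N : ℕ) (x p : ℝ) : ℂ :=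
  ∫ y : ℝ, ((hbar * KerK hbar N (x - hbar*y/2) (x + hbar*y/2) : ℝ) : ℂ) *
    Complex.exp (Complex.I * (p:ℂ) * (y:ℂ))

/-- Weyl symbol of `H_N`. -/
noncomputable def sigmaH (hbar : ℝ) (N : ℕ) (x p : ℝ) : ℂ :=
  ∫ y : ℝ, (hbar : ℂ) * KerQ hbar N (x - hbar*y/2) (x + hbar*y/2) *
    Complex.exp (Complex.I * (p:ℂ) * (y:ℂ))
/-- Airy function via the contour integral along `Re ζ = 1`:
`Ai(z) = (1/(2πi)) ∫ e^{ζ³/3 - zζ} dζ`, parametrised by `ζ = 1 + it`. -/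
noncomputable def AiryC (z : ℂ) : ℂ :=
  (1 / (2 * (Real.pi : ℂ))) *
    ∫ t : ℝ, Complex.exp ((1 + (t:ℂ)*Complex.I)^3/3 - z*(1 + (t:ℂ)*Complex.I))

/-- The Airy function on the real line (real-valued). -/
noncomputable def AiryR (x : ℝ) : ℝ := (AiryC (x:ℂ)).re

/-- Integrated Airy function `Ai₁(ξ) = ∫_ξ^∞ Ai(u) du`. -/
noncomputable def Ai1 (ξ : ℝ) : ℝ := ∫ u in Set.Ioi ξ, AiryR u

/-- The smoothed indicator `χ_D^{(N)}(x,p) = Ai₁((2N)^{2/3}(x²+p²-2μ)/(2μ))`. -/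
noncomputable def chiDN (μ : ℝ) (N : ℕ) (x p : ℝ) : ℝ :=
  Ai1 ((2*(N:ℝ)) ^ ((2:ℝ)/3) * (x^2 + p^2 - 2*μ) / (2*μ))

noncomputable def HP : ℕ → Polynomial ℝ
  | 0 => 1
  | (k+1) => 2 * Polynomial.X * HP k - Polynomial.derivative (HP k)

lemma HP_iter (k : ℕ) : iteratedDeriv k (fun t : ℝ => Real.exp (-t^2)) =
    fun y => (-1)^k * (HP k).eval y * Real.exp (-y^2) := by
  induction k with
  | zero => ext y; simp [HP]
  | succ k ih =>
    rw [iteratedDeriv_succ, ih]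
    ext y
    have h1 : HasDerivAt (fun y : ℝ => Real.exp (-y^2)) (Real.exp (-y^2) * (-(2*y))) y := by
      have := ((hasDerivAt_pow 2 y).neg).exp
      simpa using this
    have h2 := (((HP k).hasDerivAt y).const_mul ((-1:ℝ)^k)).mul h1
    have := h2.deriv
    simp only [Pi.mul_def] at this
    rw [this]
    simp [HP, pow_succ]
    ring

lemma hermiteH_eq (k : ℕ) (y : ℝ) : hermiteH k y = (HP k).eval y := by
  unfold hermiteH
  rw [HP_iter]
  have : Real.exp (y^2) * Real.exp (-y^2) = 1 := by rw [← Real.exp_add]; simp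
  have h2 : ((-1:ℝ)^k) * (-1)^k = 1 := by rw [← mul_pow]; simp
  calc _ = ((-1:ℝ)^k * (-1)^k) * (Real.exp (y^2) * Real.exp (-y^2)) * (HP k).eval y := by ring
    _ = _ := by rw [this, h2]; ring

lemma HP_deriv (k : ℕ) : Polynomial.derivative (HP (k+1)) = 2 * ((k:Polynomial ℝ)+1) * HP k := by
  induction k with
  | zero => simp [HP]
  | succ k ih =>
    rw [HP, Polynomial.derivative_sub, Polynomial.derivative_mul, ih]
    have : Polynomial.derivative (2 * ((k:Polynomial ℝ)+1) * HP k) = 2 * ((k:Polynomial ℝ)+1) * Polynomial.derivative (HP k) := by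
      rw [Polynomial.derivative_mul]; simp
    rw [this]
    have h2 : HP (k+1) = 2 * Polynomial.X * HP k - Polynomial.derivative (HP k) := rfl
    simp
    linear_combination (2 * ((k:Polynomial ℝ)+1)) * (-h2)

/-- uniform version with truncated index -/
lemma HP_deriv' (k : ℕ) : Polynomial.derivative (HP k) = 2 * (k:Polynomial ℝ) * HP (k-1) := by
  cases k with
  | zero => simp [HP]
  | succ k => rw [HP_deriv]; simp

noncomputable def HC (k : ℕ) : Polynomial ℂ := (HP k).map (algebraMap ℝ ℂ)

lemma HC_succ (k : ℕ) : HC (k+1) = 2 * Polynomial.X * HC k - 2 * (k:Polynomial ℂ) * HC (k-1) := by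
  simp [HC, HP, HP_deriv']

lemma HC_deriv (k : ℕ) : Polynomial.derivative (HC k) = 2 * (k:Polynomial ℂ) * HC (k-1) := by
  simp [HC, Polynomial.derivative_map, HP_deriv']

lemma HC_eval (k : ℕ) (y : ℝ) : (HC k).eval (y:ℂ) = ((hermiteH k y : ℝ) : ℂ) := by
  rw [hermiteH_eq, HC, Polynomial.eval_map_algebraMap]
  exact (Polynomial.aeval_algebraMap_apply_eq_algebraMap_eval (A := ℂ) y (HP k))

/-- Gaussian weight -/
noncomputable def GW (P t : ℝ) : ℂ := Complex.exp (-(t:ℂ)^2 + 2*Complex.I*P*t)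

lemma GW_norm (P t : ℝ) : ‖GW P t‖ = Real.exp (-t^2) := by
  rw [GW, Complex.norm_exp]
  congr 1
  simp [pow_two]

lemma GW_int (P : ℝ) (f : Polynomial ℂ) : Integrable (fun t : ℝ => f.eval (t:ℂ) * GW P t) := by
  have hn : ∀ n : ℕ, (-1:ℝ) < n := fun n => by
    have : (0:ℝ) ≤ n := n.cast_nonneg
    linarith
  induction f using Polynomial.induction_on' with
  | add p q hp hq => simp only [Polynomial.eval_add, add_mul]; exact hp.add hq
  | monomial n a =>
    have h := (integrable_rpow_mul_exp_neg_mul_sq (b := 1) one_pos (s := n) (hn n)).norm.const_mul ‖a‖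
    refine h.mono' (by unfold GW; fun_prop) (ae_of_all _ fun t => ?_)
    rw [norm_mul, GW_norm]
    simp [abs_of_pos (Real.exp_pos _), mul_assoc]

noncomputable def MM (P : ℝ) (f : Polynomial ℂ) : ℂ := ∫ t : ℝ, f.eval (t:ℂ) * GW P t

lemma MM_add (P : ℝ) (f g : Polynomial ℂ) : MM P (f+g) = MM P f + MM P g := by
  unfold MM
  rw [← integral_add (GW_int P f) (GW_int P g)]
  simp [add_mul]

lemma MM_smul (P : ℝ) (c : ℂ) (f : Polynomial ℂ) : MM P (Polynomial.C c * f) = c * MM P f := by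
  unfold MM
  rw [← integral_const_mul]
  simp [mul_assoc]

lemma MM_one (P : ℝ) : MM P 1 = (Real.sqrt Real.pi : ℂ) * Real.exp (-P^2) := by
  have := integral_cexp_quadratic (b := -1) (by simp) (2*Complex.I*P) 0
  simp only [MM, GW]
  simp at this ⊢
  rw [this]
  congr 1
  · rw [Real.sqrt_eq_rpow, Complex.ofReal_cpow Real.pi_pos.le]; simp
  · congr 1
    simp [mul_pow]; ring

lemma GW_deriv (P t : ℝ) : HasDerivAt (fun t : ℝ => GW P t) ((-2*(t:ℂ) + 2*Complex.I*P) * GW P t) t := by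
  unfold GW
  have h : HasDerivAt (fun z : ℂ => Complex.exp (-z^2 + 2*Complex.I*P*z)) (Complex.exp (-(t:ℂ)^2 + 2*Complex.I*P*t) * (-(2*(t:ℂ)) + 2*Complex.I*P)) t := by
    have h1 := ((hasDerivAt_pow 2 (t:ℂ)).neg).add ((hasDerivAt_id (t:ℂ)).const_mul (2*Complex.I*P))
    have := h1.cexp
    simpa using this
  have := h.comp_ofReal
  convert this using 1
  ring

lemma MM_ibp (P : ℝ) (f : Polynomial ℂ) :
    MM P (Polynomial.derivative f) + MM P ((-2 * Polynomial.X + Polynomial.C (2*Complex.I*P)) * f) = 0 := by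
  rw [← MM_add]
  unfold MM
  have key := integral_eq_zero_of_hasDerivAt_of_integrable (f := fun t : ℝ => f.eval (t:ℂ) * GW P t)
    (f' := fun t : ℝ => (Polynomial.derivative f + (-2 * Polynomial.X + Polynomial.C (2*Complex.I*P)) * f).eval (t:ℂ) * GW P t)
    (fun t => ?_) (GW_int P _) (GW_int P f)
  · exact key
  · have h1 : HasDerivAt (fun t : ℝ => f.eval (t:ℂ)) ((Polynomial.derivative f).eval (t:ℂ)) t := (f.hasDerivAt (t:ℂ)).comp_ofReal
    refine (h1.mul (GW_deriv P t)).congr_deriv ?_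
    simp only [Polynomial.eval_add, Polynomial.eval_mul, Polynomial.eval_neg, Polynomial.eval_X, Polynomial.eval_C, Polynomial.eval_ofNat]
    ring

/-- the shifted product -/
noncomputable def SP (X : ℝ) (j k : ℕ) : Polynomial ℂ :=
  (HC j).comp (Polynomial.C (X:ℂ) - Polynomial.X) * (HC k).comp (Polynomial.C (X:ℂ) + Polynomial.X)

lemma SP_deriv (X : ℝ) (j k : ℕ) : Polynomial.derivative (SP X j k) =
    -(2 * j : Polynomial ℂ) * SP X (j-1) k + (2 * k : Polynomial ℂ) * SP X j (k-1) := by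
  unfold SP
  rw [Polynomial.derivative_mul, Polynomial.derivative_comp, Polynomial.derivative_comp, HC_deriv, HC_deriv]
  simp
  ring

lemma SP_succ_left (X : ℝ) (j k : ℕ) : SP X (j+1) k =
    2 * (Polynomial.C (X:ℂ) - Polynomial.X) * SP X j k - 2 * (j : Polynomial ℂ) * SP X (j-1) k := by
  unfold SP
  rw [HC_succ]
  simp
  ring

lemma SP_succ_right (X : ℝ) (j k : ℕ) : SP X j (k+1) =
    2 * (Polynomial.C (X:ℂ) + Polynomial.X) * SP X j k - 2 * (k : Polynomial ℂ) * SP X j (k-1) := by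
  unfold SP
  rw [HC_succ]
  simp
  ring

lemma A_left (X P : ℝ) (j k : ℕ) : MM P (SP X (j+1) k) =
    2 * (X - Complex.I * P) * MM P (SP X j k) - 2 * k * MM P (SP X j (k-1)) := by
  have h := MM_ibp P (SP X j k)
  rw [← MM_add] at h
  have e : SP X (j+1) k = (Polynomial.derivative (SP X j k) + (-2 * Polynomial.X + Polynomial.C (2*Complex.I*P)) * SP X j k)
      + (Polynomial.C (2 * (X - Complex.I * P)) * SP X j k + Polynomial.C (-(2 * k : ℂ)) * SP X j (k-1)) := by
    rw [SP_deriv, SP_succ_left]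
    have c2 : (Polynomial.C (2:ℂ)) = 2 := rfl
    simp [c2]
    ring
  rw [e, MM_add, h, MM_add, MM_smul, MM_smul]
  ring

lemma A_right (X P : ℝ) (j k : ℕ) : MM P (SP X j (k+1)) =
    2 * (X + Complex.I * P) * MM P (SP X j k) - 2 * j * MM P (SP X (j-1) k) := by
  have h := MM_ibp P (SP X j k)
  rw [← MM_add] at h
  have e : SP X j (k+1) = Polynomial.C (-1) * (Polynomial.derivative (SP X j k) + (-2 * Polynomial.X + Polynomial.C (2*Complex.I*P)) * SP X j k)
      + (Polynomial.C (2 * (X + Complex.I * P)) * SP X j k + Polynomial.C (-(2 * j : ℂ)) * SP X (j-1) k) := by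
    rw [SP_deriv, SP_succ_right]
    have c2 : (Polynomial.C (2:ℂ)) = 2 := rfl
    simp [c2]
    ring
  rw [e, MM_add, MM_smul, h, MM_add, MM_smul, MM_smul]
  ring

noncomputable def BB (w z : ℂ) (j k : ℕ) : ℂ :=
  ∑ m ∈ Finset.range (j+1), (-2:ℂ)^m * (m.factorial : ℂ) * (j.choose m : ℂ) * (k.choose m : ℂ) * w^(j-m) * z^(k-m)

lemma BB_succ (w z : ℂ) (j k : ℕ) : BB w z (j+1) k = w * BB w z j k - 2 * k * BB w z j (k-1) := by
  have hz : BB w z j k = ∑ m ∈ Finset.range (j+2), (-2:ℂ)^m * (m.factorial : ℂ) * (j.choose m : ℂ) * (k.choose m : ℂ) * w^(j-m) * z^(k-m) := by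
    rw [Finset.sum_range_succ, BB]; simp
  rw [hz, Finset.sum_range_succ', BB, BB, Finset.sum_range_succ', mul_add, Finset.mul_sum, Finset.mul_sum, add_sub_right_comm, ← Finset.sum_sub_distrib]
  congr 1
  · apply Finset.sum_congr rfl
    intro m hm
    have hk : (k:ℂ) * ((k-1).choose m : ℂ) = (k.choose (m+1) : ℂ) * ((m:ℂ)+1) := by
      cases k with
      | zero => simp
      | succ k => have := Nat.add_one_mul_choose_eq k m
                  simp
                  exact_mod_cast this
    have hw : (j.choose (m+1) : ℂ) * w^(j-m) = w * ((j.choose (m+1) : ℂ) * w^(j-(m+1))) := by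
      rcases Nat.lt_or_ge m j with h | h
      · have : j - m = (j-(m+1)) + 1 := by omega
        rw [this, pow_succ]; ring
      · rw [Nat.choose_eq_zero_of_lt (by omega)]; simp
    have e1 : j + 1 - (m+1) = j - m := by omega
    have e2 : k - 1 - m = k - (m+1) := by omega
    rw [e1, e2, Nat.choose_succ_succ, Nat.factorial_succ, pow_succ]
    push_cast
    linear_combination (-2:ℂ)^m * (-2) * ((m:ℂ)+1) * (m.factorial:ℂ) * (k.choose (m+1) : ℂ) * z^(k-(m+1)) * hw + 2 * (-2:ℂ)^m * (m.factorial:ℂ) * (j.choose m : ℂ) * w^(j-m) * z^(k-(m+1)) * hk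
  · simp [pow_succ]; ring

lemma A_closed (X P : ℝ) (j k : ℕ) : MM P (SP X j k) =
    (Real.sqrt Real.pi : ℂ) * Real.exp (-P^2) * BB (2 * (X - Complex.I * P)) (2 * (X + Complex.I * P)) j k := by
  induction j generalizing k with
  | zero =>
    induction k with
    | zero =>
      have : SP X 0 0 = 1 := by simp [SP, HC, HP]
      rw [this, MM_one]; simp [BB]
    | succ k ih =>
      rw [A_right, ih]; simp [BB, pow_succ]; ring
  | succ j ih =>
    rw [A_left, ih, ih, BB_succ]; ring

noncomputable def lag (k : ℕ) (x : ℝ) : ℝ := ∑ i ∈ Finset.range (k+1), (k.choose i : ℝ) * (-1)^i / (i.factorial : ℝ) * x^i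

lemma BB_diag (X P : ℝ) (k : ℕ) : BB (2 * (X - Complex.I * P)) (2 * (X + Complex.I * P)) k k =
    ((2^k * (k.factorial : ℝ) * (-1)^k * lag k (2 * (X^2+P^2)) : ℝ) : ℂ) := by
  unfold BB lag
  rw [← Finset.sum_range_reflect, Finset.mul_sum]
  push_cast
  apply Finset.sum_congr rfl
  intro i hi
  have hi : i ≤ k := by simpa [Nat.lt_succ_iff] using hi
  have e2 : k - (k - i) = i := by omega
  rw [e2, Nat.choose_symm hi]
  have hf : (k.choose i : ℂ) * (i.factorial : ℂ) * ((k-i).factorial : ℂ) = (k.factorial : ℂ) := by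
    exact_mod_cast Nat.choose_mul_factorial_mul_factorial hi
  have hi0 : (i.factorial : ℂ) ≠ 0 := by exact_mod_cast i.factorial_ne_zero
  have h4 : (2 * (X - Complex.I * P))^i * (2 * (X + Complex.I * P))^i = (4:ℂ)^i * ((X:ℂ)^2+P^2)^i := by
    rw [← mul_pow, ← mul_pow]; congr 1
    linear_combination (-4 * (P:ℂ)^2) * Complex.I_sq
  have h5 : (-2:ℂ)^(k-i) * 4^i = 2^k * (-1)^k * (-1)^i * 2^i := by
    obtain ⟨d, rfl⟩ := Nat.exists_eq_add_of_le hi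
    have : i + d - i = d := by omega
    rw [this, pow_add, pow_add, show (4:ℂ) = 2*2 by norm_num, mul_pow, show (-2:ℂ) = (-1) * 2 by norm_num, mul_pow]
    have : (-1:ℂ)^i * (-1)^i = 1 := by rw [← mul_pow]; simp
    linear_combination (-(2:ℂ)^i * 2^d * (-1)^d * 2^i) * this
  rw [← hf]
  rw [mul_pow (2:ℂ) ((X:ℂ)^2+P^2)]
  have e3 : 2 ^ k * ((k.choose i : ℂ) * (i.factorial : ℂ) * ((k-i).factorial : ℂ)) * (-1) ^ k *
      ((k.choose i : ℂ) * (-1) ^ i / (i.factorial : ℂ) * (2 ^ i * ((X:ℂ)^2+P^2)^i)) =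
      (k.choose i : ℂ)^2 * ((k-i).factorial : ℂ) * ((X:ℂ)^2+P^2)^i * (2^k * (-1)^k * (-1)^i * 2^i) := by
    generalize ((X:ℂ)^2+P^2)^i = q
    field_simp
  rw [e3]
  generalize (2 * ((X:ℂ) - Complex.I * P))^i = a at *
  generalize (2 * ((X:ℂ) + Complex.I * P))^i = b at *
  linear_combination (-2:ℂ)^(k-i) * (k.choose i : ℂ)^2 * ((k-i).factorial : ℂ) * h4 + (k.choose i : ℂ)^2 * ((k-i).factorial : ℂ) * ((X:ℂ)^2+P^2)^i * h5


noncomputable def rho (hbar : ℝ) (N : ℕ) (u : ℝ) : ℝ :=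
  ∑ k ∈ Finset.range N, 2 * (-1)^k * Real.exp (-u/hbar) * lag k (2*u/hbar)

lemma psi_prod (s : ℝ) (hs : 0 < s) (x t : ℝ) (k : ℕ) :
    ((psiH (s^2) k (x - s*t) * psiH (s^2) k (x + s*t) : ℝ) : ℂ) =
      (((Real.sqrt Real.pi * 2^k * (Nat.factorial k) * s)⁻¹ * Real.exp (-(x/s)^2) * Real.exp (-t^2) : ℝ) : ℂ)
      * (SP (x/s) k k).eval (t:ℂ) := by
  have hsq : Real.sqrt (s^2) = s := Real.sqrt_sq hs.le
  have e1 : (x - s*t)/s = x/s - t := by field_simp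
  have e2 : (x + s*t)/s = x/s + t := by field_simp
  have h : (SP (x/s) k k).eval (t:ℂ) = ((hermiteH k (x/s - t) * hermiteH k (x/s+t) : ℝ) : ℂ) := by
    rw [SP]
    simp only [Polynomial.eval_mul, Polynomial.eval_comp, Polynomial.eval_sub, Polynomial.eval_add, Polynomial.eval_X, Polynomial.eval_C]
    rw [Complex.ofReal_mul, ← HC_eval, ← HC_eval]
    push_cast; rfl
  rw [h, ← Complex.ofReal_mul]
  congr 1
  unfold psiH
  rw [hsq, e1, e2]
  set c := Real.sqrt Real.pi * 2^k * (Nat.factorial k) * s with hc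
  have hc0 : 0 ≤ c := by positivity
  have h2 : (Real.sqrt c)⁻¹ * (Real.sqrt c)⁻¹ = c⁻¹ := by
    rw [← mul_inv, Real.mul_self_sqrt hc0]
  have h3 : Real.exp (-(x-s*t)^2/(2*s^2)) * Real.exp (-(x+s*t)^2/(2*s^2)) = Real.exp (-(x/s)^2) * Real.exp (-t^2) := by
    rw [← Real.exp_add, ← Real.exp_add]; congr 1
    field_simp; ring
  calc _ = ((Real.sqrt c)⁻¹ * (Real.sqrt c)⁻¹) * (Real.exp (-(x-s*t)^2/(2*s^2)) * Real.exp (-(x+s*t)^2/(2*s^2))) * (hermiteH k (x/s - t) * hermiteH k (x/s+t)) := by ring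
    _ = _ := by rw [h2, h3]; ring

lemma sigmaP_eq' (s : ℝ) (hs : 0 < s) (N : ℕ) (x p : ℝ) :
    sigmaP (s^2) N x p = ((rho (s^2) N (x^2+p^2) : ℝ) : ℂ) := by
  unfold sigmaP
  have hs0 : s ≠ 0 := hs.ne'
  have hsc : (s:ℂ) ≠ 0 := by exact_mod_cast hs0
  set F : ℝ → ℂ := fun y => ((s^2 * KerK (s^2) N (x - s^2*y/2) (x + s^2*y/2) : ℝ) : ℂ) *
    Complex.exp (Complex.I * (p:ℂ) * (y:ℂ)) with hF
  have h1 := Measure.integral_comp_mul_left F (2/s)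
  have h2 : ∫ y, F y = (2/s : ℝ) • ∫ t, F (2/s*t) := by
    rw [h1, smul_smul, abs_of_pos (by positivity)]
    rw [mul_inv_cancel₀ (by positivity), one_smul]
  rw [h2]
  have h3 : ∀ t : ℝ, F (2/s*t) = ∑ k ∈ Finset.range N, 
      (((s^2 * (Real.sqrt Real.pi * 2^k * (Nat.factorial k) * s)⁻¹ * Real.exp (-(x/s)^2)) : ℝ) : ℂ) * ((SP (x/s) k k).eval (t:ℂ) * GW (p/s) t) := by
    intro t
    simp only [hF, KerK]
    have e1 : s^2*(2/s*t)/2 = s*t := by field_simp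
    rw [e1]
    push_cast
    rw [Finset.mul_sum, Finset.sum_mul]
    apply Finset.sum_congr rfl
    intro k _
    have := psi_prod s hs x t k
    push_cast at this
    rw [this, GW]
    have e2 : Complex.exp (-(t:ℂ)^2 + 2*Complex.I*((p/s:ℝ):ℂ)*t) = Complex.exp (-(t:ℂ)^2) * Complex.exp (Complex.I * p * (2/s*t)) := by
      rw [← Complex.exp_add]; congr 1; push_cast; field_simp
    rw [e2]
    push_cast
    ring
  simp_rw [h3]
  rw [integral_finsetSum]
  swap
  · intro k _
    exact (GW_int (p/s) _).const_mul _
  simp_rw [integral_const_mul]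
  unfold rho
  rw [Finset.smul_sum, Complex.ofReal_sum]
  apply Finset.sum_congr rfl
  intro k _
  have := A_closed (x/s) (p/s) k k
  unfold MM at this
  rw [this, BB_diag, Complex.real_smul]
  have e3 : 2 * ((x/s)^2+(p/s)^2) = 2*(x^2+p^2)/s^2 := by field_simp
  rw [e3]
  have e4 : Real.exp (-(x^2+p^2)/s^2) = Real.exp (-(x/s)^2) * Real.exp (-(p/s)^2) := by
    rw [← Real.exp_add]; congr 1; field_simp; ring
  rw [e4]
  have hk : (k.factorial : ℝ) ≠ 0 := by exact_mod_cast k.factorial_ne_zero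
  have hpi : Real.sqrt Real.pi ≠ 0 := by positivity
  simp only [← Complex.ofReal_mul]
  congr 1
  field_simp

lemma sigmaP_eq (h : ℝ) (hh : 0 < h) (N : ℕ) (x p : ℝ) :
    sigmaP h N x p = ((rho h N (x^2+p^2) : ℝ) : ℂ) := by
  have := sigmaP_eq' (Real.sqrt h) (Real.sqrt_pos.2 hh) N x p
  rwa [Real.sq_sqrt hh.le] at this


lemma E_int (i : ℕ) (β : ℂ) (hβ : 0 < β.re) :
    IntegrableOn (fun u : ℝ => (u:ℂ)^i * Complex.exp (-(β*u))) (Set.Ioi 0) := by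
  have hi : (-1:ℝ) < i := by
    have : (0:ℝ) ≤ i := i.cast_nonneg
    linarith
  have h := integrableOn_rpow_mul_exp_neg_mul_rpow (p := 1) hi one_pos hβ
  refine Integrable.mono' h (by fun_prop) ?_
  refine (ae_restrict_iff' measurableSet_Ioi).2 (ae_of_all _ fun u hu => ?_)
  have hu : 0 < u := hu
  simp [Complex.norm_exp, abs_of_pos hu]

lemma E_val (i : ℕ) (β : ℂ) (hβ : 0 < β.re) :
    ∫ u in Set.Ioi (0:ℝ), (u:ℂ)^i * Complex.exp (-(β*u)) = (i.factorial : ℂ) * (β⁻¹)^(i+1) := by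
  have hb0 : β ≠ 0 := by rintro rfl; simp at hβ
  induction i with
  | zero =>
    have := integral_exp_mul_complex_Ioi (a := -β) (by simpa using hβ) 0
    simp at this ⊢
    rw [this]
  | succ i ih =>
    have hd : ∀ u : ℝ, HasDerivAt (fun u : ℝ => (u:ℂ)^(i+1) * Complex.exp (-(β*u)))
        (((i:ℂ)+1) * ((u:ℂ)^i * Complex.exp (-(β*u))) - β * ((u:ℂ)^(i+1) * Complex.exp (-(β*u)))) u := by
      intro u
      have h1 : HasDerivAt (fun z : ℂ => z^(i+1) * Complex.exp (-(β*z)))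
        (((i:ℂ)+1) * ((u:ℂ)^i * Complex.exp (-(β*u))) - β * ((u:ℂ)^(i+1) * Complex.exp (-(β*u)))) (u:ℂ) := by
        have h2 := (hasDerivAt_pow (i+1) (u:ℂ)).mul (((hasDerivAt_id (u:ℂ)).const_mul β).neg.cexp)
        refine h2.congr_deriv ?_
        simp; ring
      exact h1.comp_ofReal
    have ht : Tendsto (fun u : ℝ => (u:ℂ)^(i+1) * Complex.exp (-(β*u))) atTop (nhds 0) := by
      rw [tendsto_zero_iff_norm_tendsto_zero]
      refine (tendsto_rpow_mul_exp_neg_mul_atTop_nhds_zero ((i+1:ℕ):ℝ) β.re hβ).congr' ?_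
      filter_upwards [eventually_gt_atTop 0] with u hu
      rw [Real.rpow_natCast]
      simp [Complex.norm_exp, abs_of_pos hu]
    have key := integral_Ioi_of_hasDerivAt_of_tendsto' (a := 0) (fun u _ => hd u)
      (((E_int i β hβ).const_mul _).sub ((E_int (i+1) β hβ).const_mul _)) ht
    rw [integral_sub ((E_int i β hβ).const_mul _) ((E_int (i+1) β hβ).const_mul _), integral_const_mul, integral_const_mul, ih] at key
    simp at key
    rw [Nat.factorial_succ, inv_pow, pow_succ β]
    push_cast
    have := sub_eq_zero.1 key
    field_simp at this ⊢
    linear_combination -this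

lemma rho_expand (h : ℝ) (hh : 0 < h) (N : ℕ) (α : ℂ) (u : ℝ) :
    ((rho h N u : ℝ) : ℂ) * Complex.exp (α*u) =
    ∑ k ∈ Finset.range N, ∑ i ∈ Finset.range (k+1), (2 * (-1)^k * ((k.choose i : ℂ) * (-1)^i / (i.factorial : ℂ)) * (2/h)^i) * ((u:ℂ)^i * Complex.exp (-((1/h - α)*u))) := by
  unfold rho lag
  push_cast
  rw [Finset.sum_mul]
  apply Finset.sum_congr rfl
  intro k _
  rw [Finset.mul_sum, Finset.sum_mul]
  apply Finset.sum_congr rfl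
  intro i _
  have : Complex.exp (-((1/h - α)*u)) = Complex.exp (-u/h) * Complex.exp (α*u) := by
    rw [← Complex.exp_add]; congr 1; ring
  rw [this, show (2*(u:ℂ)/h) = 2/h*u by ring, mul_pow]
  ring

lemma rho_int (h : ℝ) (hh : 0 < h) (N : ℕ) (α : ℂ) (hα : α.re < 1/h) :
    IntegrableOn (fun u : ℝ => ((rho h N u : ℝ) : ℂ) * Complex.exp (α*u)) (Set.Ioi 0) := by
  simp_rw [rho_expand h hh]
  have hb : 0 < (1/(h:ℂ) - α).re := by
    have : (1/(h:ℂ)).re = 1/h := by rw [← Complex.ofReal_one, ← Complex.ofReal_div, Complex.ofReal_re]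
    rw [Complex.sub_re, this]; linarith
  refine integrable_finsetSum _ fun k _ => integrable_finsetSum _ fun i _ => ?_
  exact (E_int i _ hb).const_mul _

lemma rho_laplace (h : ℝ) (hh : 0 < h) (N : ℕ) (α : ℂ) (hα : α.re < 1/h) (h0 : α ≠ 0) :
    ∫ u in Set.Ioi (0:ℝ), ((rho h N u : ℝ) : ℂ) * Complex.exp (α*u) =
      (((1+h*α)/(1-h*α))^N - 1)/α := by
  have hb : 0 < (1/(h:ℂ) - α).re := by
    have : (1/(h:ℂ)).re = 1/h := by rw [← Complex.ofReal_one, ← Complex.ofReal_div, Complex.ofReal_re]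
    rw [Complex.sub_re, this]; linarith
  have hb0 : 1/(h:ℂ) - α ≠ 0 := by intro hz; rw [hz] at hb; simp at hb
  have hhc : (h:ℂ) ≠ 0 := by exact_mod_cast hh.ne'
  simp_rw [rho_expand h hh]
  rw [integral_finsetSum]
  swap
  · exact fun k _ => integrable_finsetSum _ fun i _ => (E_int i _ hb).const_mul _
  have hk : ∀ k ∈ Finset.range N, ∫ u in Set.Ioi (0:ℝ), ∑ i ∈ Finset.range (k+1), (2 * (-1)^k * ((k.choose i : ℂ) * (-1)^i / (i.factorial : ℂ)) * (2/h)^i) * ((u:ℂ)^i * Complex.exp (-((1/h - α)*u)))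
      = 2 * (1/h-α)⁻¹ * ((1+h*α)/(1-h*α))^k := by
    intro k _
    rw [integral_finsetSum _ (fun i _ => (E_int i _ hb).const_mul _)]
    simp_rw [integral_const_mul, E_val _ _ hb]
    have e : ((1+h*α)/(1-h*α)) = (-1) * ((-(2/h) * (1/h-α)⁻¹) + 1) := by
      have : 1 - h*α ≠ 0 := by
        intro hz; apply hb0; rw [show 1/(h:ℂ)-α = (1-h*α)/h by field_simp, hz, zero_div]
      have e1 : (1/(h:ℂ)-α)⁻¹ = h / (1-h*α) := by
        rw [show 1/(h:ℂ)-α = (1-h*α)/h by field_simp, inv_div]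
      rw [e1]
      field_simp
      ring
    rw [e, mul_pow, add_pow, Finset.mul_sum, Finset.mul_sum]
    apply Finset.sum_congr rfl
    intro i _
    have : (i.factorial : ℂ) ≠ 0 := by exact_mod_cast i.factorial_ne_zero
    rw [mul_pow, neg_pow (2/(h:ℂ)), pow_succ]
    generalize (1/(h:ℂ)-α)⁻¹ = b
    field_simp
    simp
  rw [Finset.sum_congr rfl hk, ← Finset.mul_sum]
  have hd : 1 - h*α ≠ 0 := by
    intro hz; apply hb0; rw [show 1/(h:ℂ)-α = (1-h*α)/h by field_simp, hz, zero_div]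
  have e1 : (1/(h:ℂ)-α)⁻¹ = h / (1-h*α) := by
    rw [show 1/(h:ℂ)-α = (1-h*α)/h by field_simp, inv_div]
  have hq : (1+h*α)/(1-h*α) - 1 = 2*(h*α)/(1-h*α) := by field_simp; ring
  have hq1 : (1+h*α)/(1-h*α) ≠ 1 := by
    rw [← sub_ne_zero, hq]
    exact div_ne_zero (by simp [hhc, h0]) hd
  rw [geom_sum_eq hq1, hq, e1]
  field_simp


noncomputable def bN (μ : ℝ) (N : ℕ) : ℝ := (μ/N) ^ ((1:ℝ)/3)

lemma bN_cube (μ : ℝ) (hμ : 0 < μ) (N : ℕ) : (bN μ N)^3 = μ/N := by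
  unfold bN
  rw [← Real.rpow_natCast, ← Real.rpow_mul (by positivity)]
  norm_num

lemma bN_pos (μ : ℝ) (hμ : 0 < μ) (N : ℕ) (hN : 0 < N) : 0 < bN μ N := by
  unfold bN
  have : (0:ℝ) < N := by exact_mod_cast hN
  positivity

lemma bN_tendsto (μ : ℝ) : Tendsto (bN μ) atTop (nhds 0) := by
  unfold bN
  have h := tendsto_const_div_atTop_nhds_zero_nat μ
  have := h.rpow_const (p := (1:ℝ)/3) (Or.inr (by norm_num))
  simpa [Real.zero_rpow] using this

lemma num_bound (δ : ℂ) (hδ : ‖δ‖ ≤ 1/2) :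
    ‖((1+δ) * Complex.exp (-2*δ) - (1-δ)) - (2/3)*δ^3‖ ≤ 10 * ‖δ‖^4 := by
  have h1 : ‖-2*δ‖ ≤ 1 := by rw [norm_mul]; norm_num; linarith
  have h := Complex.exp_bound h1 (n := 4) (by norm_num)
  rw [norm_mul] at h
  norm_num [Finset.sum_range_succ, Nat.factorial] at h
  set R := Complex.exp (-(2*δ)) - (1 + -(2*δ) + (2*δ)^2/2 + (-(2*δ))^3/6) with hR
  have e : ((1+δ) * Complex.exp (-2*δ) - (1-δ)) - (2/3)*δ^3 = (1+δ) * R + (-(4/3)) * δ^4 := by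
    rw [hR, show -2*δ = -(2*δ) by ring]; ring
  rw [e]
  have h2 : ‖1+δ‖ ≤ 3/2 := by
    calc _ ≤ ‖(1:ℂ)‖ + ‖δ‖ := norm_add_le _ _
      _ ≤ _ := by simp; linarith
  have h4 : 0 ≤ ‖δ‖^4 := by positivity
  have h3 : ‖R‖ ≤ ‖δ‖^4 := by
    refine h.trans ?_
    nlinarith
  calc _ ≤ ‖(1+δ)*R‖ + ‖(-(4/3):ℂ) * δ^4‖ := norm_add_le _ _
    _ = ‖1+δ‖ * ‖R‖ + 4/3 * ‖δ‖^4 := by rw [norm_mul, norm_mul, norm_pow]; norm_num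
    _ ≤ 3/2 * ‖δ‖^4 + 4/3 * ‖δ‖^4 := by gcongr
    _ ≤ _ := by linarith

lemma deltaN_tendsto (μ : ℝ) (ζ : ℂ) : Tendsto (fun N : ℕ => ζ * (bN μ N : ℂ)) atTop (nhds 0) := by
  have : Tendsto (fun N : ℕ => (bN μ N : ℂ)) atTop (nhds 0) := by
    have := (Complex.continuous_ofReal.tendsto 0).comp (bN_tendsto μ)
    rw [Complex.ofReal_zero] at this
    exact this
  simpa using this.const_mul ζ

lemma num_tendsto (μ : ℝ) (hμ : 0 < μ) (ζ : ℂ) :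
    Tendsto (fun N : ℕ => (N:ℂ) * ((1+ζ * (bN μ N : ℂ)) * Complex.exp (-2*(ζ * (bN μ N : ℂ))) - (1-ζ * (bN μ N : ℂ)))) atTop
      (nhds (2/3 * μ * ζ^3)) := by
  rw [tendsto_iff_norm_sub_tendsto_zero]
  have hlim : Tendsto (fun N : ℕ => 10 * ‖ζ‖^4 * μ * bN μ N) atTop (nhds 0) := by
    simpa using (bN_tendsto μ).const_mul (10 * ‖ζ‖^4 * μ)
  refine squeeze_zero' (Eventually.of_forall fun _ => norm_nonneg _) ?_ hlim
  have hd := (deltaN_tendsto μ ζ).norm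
  rw [norm_zero] at hd
  filter_upwards [hd.eventually_le_const (show (0:ℝ) < 1/2 by norm_num), eventually_gt_atTop 0] with N h1 hN
  have hN' : (0:ℝ) < N := by exact_mod_cast hN
  have hb := bN_pos μ hμ N hN
  have hc := bN_cube μ hμ N
  have hc1 : (N:ℝ) * (bN μ N)^3 = μ := by rw [hc]; field_simp
  have hc2 : (N:ℂ) * (bN μ N : ℂ)^3 = μ := by exact_mod_cast hc1
  have hnb := num_bound _ h1
  set δ := ζ * (bN μ N : ℂ) with hδ
  have e : (N:ℂ) * ((1+δ) * Complex.exp (-2*δ) - (1-δ)) - 2/3*μ*ζ^3 = (N:ℂ) * (((1+δ) * Complex.exp (-2*δ) - (1-δ)) - (2/3)*δ^3) := by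
    rw [← hc2, mul_sub (N:ℂ) _ ((2/3)*δ^3), hδ]; ring
  rw [e, norm_mul]
  have hdn : ‖δ‖ = ‖ζ‖ * bN μ N := by rw [hδ, norm_mul, Complex.norm_real, Real.norm_of_nonneg hb.le]
  calc _ ≤ ‖(N:ℂ)‖ * (10 * ‖δ‖^4) := by gcongr
    _ = 10 * ‖ζ‖^4 * (N * (bN μ N)^3) * bN μ N := by rw [hdn]; simp; ring
    _ = _ := by rw [hc1]

lemma q_tendsto (μ : ℝ) (hμ : 0 < μ) (ζ : ℂ) :
    Tendsto (fun N : ℕ => Complex.exp (-2 * N * (ζ * (bN μ N : ℂ))) * ((1+ζ * (bN μ N : ℂ))/(1-ζ * (bN μ N : ℂ)))^N) atTop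
      (nhds (Complex.exp (2/3 * μ * ζ^3))) := by
  have h1 : Tendsto (fun N : ℕ => (1 - ζ * (bN μ N : ℂ))) atTop (nhds 1) := by
    simpa using (deltaN_tendsto μ ζ).const_sub 1
  have h2 := (num_tendsto μ hμ ζ).div h1 one_ne_zero
  rw [div_one] at h2
  have h3 := Complex.tendsto_one_add_pow_exp_of_tendsto (g := fun N : ℕ => ((1+ζ * (bN μ N : ℂ)) * Complex.exp (-2*(ζ * (bN μ N : ℂ))) - (1-ζ * (bN μ N : ℂ))) / (1 - ζ * (bN μ N : ℂ)))
    (h2.congr fun N => by simp only [Pi.div_apply]; rw [mul_div_assoc])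
  refine h3.congr' ?_
  filter_upwards [h1.eventually_ne one_ne_zero] with N hN
  have e : Complex.exp (-2 * N * (ζ * (bN μ N : ℂ))) = Complex.exp (-2 * (ζ * (bN μ N : ℂ)))^N := by
    rw [← Complex.exp_nat_mul]; congr 1; ring
  rw [e, ← mul_pow]
  congr 1
  field_simp
  ring

lemma q_norm (a b : ℝ) (hd0 : 0 ≤ a*b) (hd : a * b < 1) (ζ : ℂ) (hζ : ζ.re = a) :
    ‖(1+ζ * (b:ℂ))/(1-ζ * (b : ℂ))‖ ≤ ‖(1+(a:ℂ) * (b:ℂ))/(1-(a:ℂ) * (b : ℂ))‖ := by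
  have e1 : ‖1+(a:ℂ) * (b:ℂ)‖ = 1 + a*b := by
    rw [show 1+(a:ℂ) * (b:ℂ) = ((1+a*b:ℝ):ℂ) by push_cast; ring, Complex.norm_real, Real.norm_of_nonneg (by linarith)]
  have e2 : ‖1-(a:ℂ) * (b:ℂ)‖ = 1 - a*b := by
    rw [show 1-(a:ℂ) * (b:ℂ) = ((1-a*b:ℝ):ℂ) by push_cast; ring, Complex.norm_real, Real.norm_of_nonneg (by linarith)]
  rw [norm_div, norm_div, e1, e2]
  have hre : (ζ * (b:ℂ)).re = a * b := by simp [hζ]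
  have hpos : 0 < ‖1 - ζ*(b:ℂ)‖ := by
    rw [norm_pos_iff]; intro h
    have := congrArg Complex.re h
    rw [Complex.sub_re, hre] at this
    simp at this; linarith
  rw [div_le_div_iff₀ hpos (by linarith)]
  apply le_of_sq_le_sq _ (by positivity)
  rw [mul_pow, mul_pow, Complex.sq_norm, Complex.sq_norm, Complex.normSq_apply, Complex.normSq_apply]
  simp only [Complex.add_re, Complex.sub_re, Complex.add_im, Complex.sub_im, hre, Complex.one_re, Complex.one_im]
  set v := (ζ * (b:ℂ)).im
  nlinarith [mul_nonneg hd0 (mul_self_nonneg v)]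

noncomputable def JN (μ : ℝ) (N : ℕ) (ζ : ℂ) : ℂ :=
  Complex.exp (-2 * N * (ζ * (bN μ N : ℂ))) * (((1+ζ * (bN μ N : ℂ))/(1-ζ * (bN μ N : ℂ)))^N - 1) / ζ

lemma Nb_tendsto (μ : ℝ) (hμ : 0 < μ) : Tendsto (fun N : ℕ => (N:ℝ) * bN μ N) atTop atTop := by
  have h : Tendsto (fun N : ℕ => μ * ((bN μ N)^2)⁻¹) atTop atTop := by
    apply Tendsto.const_mul_atTop hμ
    apply Tendsto.inv_tendsto_nhdsGT_zero
    rw [tendsto_nhdsWithin_iff]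
    refine ⟨by simpa using (bN_tendsto μ).pow 2, ?_⟩
    filter_upwards [eventually_gt_atTop 0] with N hN
    have := bN_pos μ hμ N hN
    simp only [Set.mem_Ioi]; positivity
  refine h.congr' ?_
  filter_upwards [eventually_gt_atTop 0] with N hN
  have hb := bN_pos μ hμ N hN
  have hN' : (0:ℝ) < N := by exact_mod_cast hN
  have hc1 : (N:ℝ) * (bN μ N)^3 = μ := by rw [bN_cube μ hμ N]; field_simp
  rw [← div_eq_mul_inv, div_eq_iff (by positivity)]
  linarith

lemma expN_norm (μ : ℝ) (N : ℕ) (ζ : ℂ) : ‖Complex.exp (-2 * N * (ζ * (bN μ N : ℂ)))‖ = Real.exp (-(2 * ζ.re * (N * bN μ N))) := by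
  rw [Complex.norm_exp]; congr 1
  have : (-2 * N * (ζ * (bN μ N : ℂ))) = ((-2 * N * bN μ N : ℝ) : ℂ) * ζ := by push_cast; ring
  rw [this, Complex.re_ofReal_mul]; ring

lemma expN_tendsto (μ : ℝ) (hμ : 0 < μ) (ζ : ℂ) (hζ : 0 < ζ.re) :
    Tendsto (fun N : ℕ => Complex.exp (-2 * N * (ζ * (bN μ N : ℂ)))) atTop (nhds 0) := by
  rw [tendsto_zero_iff_norm_tendsto_zero]
  simp_rw [expN_norm]
  apply Real.tendsto_exp_neg_atTop_nhds_zero.comp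
  exact (Nb_tendsto μ hμ).const_mul_atTop (by positivity)

lemma JN_tendsto (μ : ℝ) (hμ : 0 < μ) (ζ : ℂ) (hζ : 0 < ζ.re) :
    Tendsto (fun N : ℕ => JN μ N ζ) atTop (nhds (Complex.exp (2/3 * μ * ζ^3) / ζ)) := by
  have h := ((q_tendsto μ hμ ζ).sub (expN_tendsto μ hμ ζ hζ)).div_const ζ
  rw [sub_zero] at h
  refine h.congr fun N => ?_
  rw [JN]; ring

lemma JN_bound (μ : ℝ) (hμ : 0 < μ) (a : ℝ) (ha : 0 < a) :
    ∃ C : ℝ, ∀ᶠ N : ℕ in atTop, ∀ ζ : ℂ, ζ.re = a → ‖JN μ N ζ‖ ≤ C := by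
  have h := (q_tendsto μ hμ a).norm
  set L := ‖Complex.exp (2/3 * μ * (a:ℂ)^3)‖
  refine ⟨(L + 1 + 1)/a, ?_⟩
  have hab : Tendsto (fun N => a * bN μ N) atTop (nhds 0) := by simpa using (bN_tendsto μ).const_mul a
  filter_upwards [h.eventually_le_const (show L < L+1 by linarith), hab.eventually_lt_const one_pos, eventually_gt_atTop 0] with N h1 h2 hN ζ hζ
  have hb := bN_pos μ hμ N hN
  have hq := q_norm a (bN μ N) (by positivity) h2 ζ hζ
  have hz : a ≤ ‖ζ‖ := by rw [← hζ]; exact Complex.re_le_norm ζ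
  rw [JN, norm_div]
  have e : Complex.exp (-2 * N * (ζ * (bN μ N : ℂ))) * (((1+ζ * (bN μ N : ℂ))/(1-ζ * (bN μ N : ℂ)))^N - 1)
    = Complex.exp (-2 * N * (ζ * (bN μ N : ℂ))) * ((1+ζ * (bN μ N : ℂ))/(1-ζ * (bN μ N : ℂ)))^N - Complex.exp (-2 * N * (ζ * (bN μ N : ℂ))) := by ring
  have he := expN_norm μ N ζ
  have hea := expN_norm μ N a
  rw [hζ] at he
  rw [Complex.ofReal_re] at hea
  have h3 : ‖Complex.exp (-2 * N * (ζ * (bN μ N : ℂ))) * ((1+ζ * (bN μ N : ℂ))/(1-ζ * (bN μ N : ℂ)))^N‖ ≤ L + 1 := by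
    refine le_trans ?_ h1
    rw [norm_mul, norm_mul, he, hea, norm_pow, norm_pow]
    gcongr
  have h4 : ‖Complex.exp (-2 * N * (ζ * (bN μ N : ℂ)))‖ ≤ 1 := by
    rw [he, Real.exp_le_one_iff]
    have : 0 ≤ 2 * a * (N * bN μ N) := by positivity
    linarith
  rw [e]
  have h5 := norm_sub_le (Complex.exp (-2 * N * (ζ * (bN μ N : ℂ))) * ((1+ζ * (bN μ N : ℂ))/(1-ζ * (bN μ N : ℂ)))^N) (Complex.exp (-2 * N * (ζ * (bN μ N : ℂ))))
  gcongr
  linarith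

noncomputable def zet (a ω : ℝ) : ℂ := (a:ℂ) + 2 * Real.pi * ω * Complex.I

lemma zet_re (a ω : ℝ) : (zet a ω).re = a := by simp [zet]

lemma limit_J (μ : ℝ) (hμ : 0 < μ) (a : ℝ) (ha : 0 < a) (H : ℝ → ℂ) (hH : Integrable H) :
    Tendsto (fun N : ℕ => ∫ ω, H ω * JN μ N (zet a ω)) atTop
      (nhds (∫ ω, H ω * (Complex.exp (2/3 * μ * (zet a ω)^3) / zet a ω))) := by
  obtain ⟨C, hC⟩ := JN_bound μ hμ a ha
  apply tendsto_integral_filter_of_dominated_convergence (fun ω => ‖H ω‖ * C)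
  · refine Eventually.of_forall fun N => hH.aestronglyMeasurable.mul ?_
    apply Measurable.aestronglyMeasurable
    unfold JN zet
    fun_prop
  · filter_upwards [hC] with N hN
    refine ae_of_all _ fun ω => ?_
    rw [norm_mul]
    gcongr
    exact hN _ (zet_re a ω)
  · exact hH.norm.mul_const C
  · refine ae_of_all _ fun ω => ?_
    exact (JN_tendsto μ hμ _ (by rw [zet_re]; exact ha)).const_mul _


noncomputable def hh (g : ℝ → ℝ) (a w : ℝ) : ℂ := ((Real.exp (-a*w) * g w : ℝ) : ℂ)

noncomputable def HH (g : ℝ → ℝ) (a ω : ℝ) : ℂ := FourierTransform.fourier (hh g a) ω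

lemma HH_eq (g : ℝ → ℝ) (a ω : ℝ) : HH g a ω = ∫ w : ℝ, (g w : ℂ) * Complex.exp (-(zet a ω * w)) := by
  unfold HH
  rw [Real.fourier_eq']
  apply integral_congr_ae
  refine ae_of_all _ fun w => ?_
  simp only [hh, zet, smul_eq_mul]
  push_cast
  have : Complex.exp (-(((a:ℂ) + 2 * Real.pi * ω * Complex.I) * w)) = Complex.exp (-2 * Real.pi * (inner ℝ w ω : ℝ) * Complex.I) * Complex.exp (-a*w) := by
    rw [← Complex.exp_add]; congr 1
    simp; ring
  rw [this]; ring

lemma hh_smooth (g : ℝ → ℝ) (hg : ContDiff ℝ (⊤ : ℕ∞) g) (a : ℝ) : ContDiff ℝ (⊤ : ℕ∞) (hh g a) := by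
  unfold hh
  have h : ContDiff ℝ (⊤ : ℕ∞) (fun w => Real.exp (-a*w) * g w) := by fun_prop
  exact Complex.ofRealCLM.contDiff.comp h

lemma hh_supp (g : ℝ → ℝ) (hg : HasCompactSupport g) (a : ℝ) : HasCompactSupport (hh g a) := by
  apply hg.mono
  intro w hw
  simp only [hh, Function.mem_support] at hw ⊢
  intro h; apply hw; simp [h]

lemma HH_int (g : ℝ → ℝ) (hg : ContDiff ℝ (⊤ : ℕ∞) g) (hs : HasCompactSupport g) (a : ℝ) : Integrable (HH g a) := by
  have := (FourierTransform.fourier ((hh_supp g hs a).toSchwartzMap (hh_smooth g hg a))).integrable (μ := volume)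
  rw [SchwartzMap.fourier_coe] at this
  exact this

lemma g_inv (g : ℝ → ℝ) (hg : ContDiff ℝ (⊤ : ℕ∞) g) (hs : HasCompactSupport g) (a w : ℝ) :
    (g w : ℂ) = ∫ ω : ℝ, HH g a ω * Complex.exp (zet a ω * w) := by
  have hc : Continuous (hh g a) := (hh_smooth g hg a).continuous
  have h := congrFun (hc.fourierInv_fourier_eq (hc.integrable_of_hasCompactSupport (hh_supp g hs a)) (HH_int g hg hs a)) w
  rw [Real.fourierInv_eq'] at h
  have h2 : (g w : ℂ) = Complex.exp (a*w) * hh g a w := by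
    simp only [hh]; push_cast
    rw [← mul_assoc, ← Complex.exp_add]; simp
  rw [h2, ← h, ← integral_const_mul]
  apply integral_congr_ae
  refine ae_of_all _ fun ω => ?_
  simp only [smul_eq_mul, zet, HH]
  have : Complex.exp (((a:ℂ) + 2 * Real.pi * ω * Complex.I) * w) = Complex.exp (a*w) * Complex.exp (((2 * Real.pi * inner ℝ ω w : ℝ):ℂ) * Complex.I) := by
    rw [← Complex.exp_add]; congr 1
    push_cast; simp; ring
  rw [this]; ring

lemma rho_cont (h : ℝ) (N : ℕ) : Continuous (rho h N) := by
  unfold rho lag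
  fun_prop

lemma I_J (μ : ℝ) (hμ : 0 < μ) (g : ℝ → ℝ) (hg : ContDiff ℝ (⊤ : ℕ∞) g) (hs : HasCompactSupport g)
    (a : ℝ) (ha : 0 < a) (N : ℕ) (hN : 0 < N) (hab : a * bN μ N < 1) :
    ∫ u in Set.Ioi (0:ℝ), ((rho (μ/N) N u : ℝ):ℂ) * ((((bN μ N)^2)⁻¹ * g ((u - 2*μ)/(bN μ N)^2) : ℝ) : ℂ) =
      ∫ ω, HH g a ω * JN μ N (zet a ω) := by
  have hb := bN_pos μ hμ N hN
  have hc := bN_cube μ hμ N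
  have hN' : (0:ℝ) < N := by exact_mod_cast hN
  have hc1 : (N:ℝ) * (bN μ N)^3 = μ := by rw [hc]; field_simp
  rw [← hc]
  unfold JN
  set b := bN μ N with hbdef
  have hbc : (b:ℂ) ≠ 0 := by exact_mod_cast hb.ne'
  have hc2 : (N:ℂ) * (b:ℂ)^3 = μ := by exact_mod_cast hc1
  have hre : ∀ ω, (zet a ω / (b:ℂ)^2).re = a / b^2 := fun ω => by
    rw [← Complex.ofReal_pow, Complex.div_ofReal_re, zet_re]
  have hlt : a / b^2 < 1 / b^3 := by
    rw [div_lt_div_iff₀ (by positivity) (by positivity)]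
    nlinarith [mul_pos hb hb]
  let f : ℝ → ℝ → ℂ := fun u ω => ((rho (b^3) N u : ℝ):ℂ) * ((b:ℂ)^2)⁻¹ * (HH g a ω * Complex.exp (zet a ω * ((u-2*μ)/b^2 : ℝ)))
  have e1 : ∀ u : ℝ, ((rho (b^3) N u : ℝ):ℂ) * (((b^2)⁻¹ * g ((u - 2*μ)/b^2) : ℝ) : ℂ) = ∫ ω, f u ω := by
    intro u
    simp only [f]
    rw [integral_const_mul, ← g_inv g hg hs]
    push_cast; ring
  simp_rw [e1]
  have hF := rho_int (b^3) (by positivity) N ((a/b^2 : ℝ):ℂ) (by rw [Complex.ofReal_re]; exact hlt)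
  have hH := HH_int g hg hs a
  rw [integral_integral_swap]
  · apply integral_congr_ae
    refine ae_of_all _ fun ω => ?_
    have hz0 : zet a ω ≠ 0 := by
      intro h; have := zet_re a ω; rw [h] at this; simp at this; linarith
    have e2 : ∀ u : ℝ, f u ω = (((b:ℂ)^2)⁻¹ * HH g a ω * Complex.exp (-2 * N * (zet a ω * b))) * (((rho (b^3) N u : ℝ):ℂ) * Complex.exp (zet a ω / (b:ℂ)^2 * u)) := by
      intro u
      have : Complex.exp (zet a ω * ((u-2*μ)/b^2 : ℝ)) = Complex.exp (-2 * N * (zet a ω * b)) * Complex.exp (zet a ω / (b:ℂ)^2 * u) := by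
        rw [← Complex.exp_add]; congr 1
        push_cast
        rw [← hc2]; field_simp; ring
      simp only [f]; rw [this]; ring
    simp_rw [e2]
    rw [integral_const_mul, rho_laplace _ (by positivity) _ _ (by rw [hre]; exact hlt) (div_ne_zero hz0 (pow_ne_zero _ hbc))]
    have e3 : ((b^3 : ℝ):ℂ) * (zet a ω / (b:ℂ)^2) = zet a ω * b := by push_cast; field_simp
    rw [e3]
    field_simp
  · have hp := (hF.mul_prod hH).const_mul (((b:ℂ)^2)⁻¹ * Complex.exp (zet a 0 * (-2*μ/b^2 : ℝ)))
    refine hp.mono ?_ (ae_of_all _ fun z => ?_)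
    · have h1 : AEStronglyMeasurable (fun z : ℝ × ℝ => HH g a z.2) ((volume.restrict (Set.Ioi 0)).prod volume) :=
        hH.aestronglyMeasurable.comp_snd
      have h2 : Continuous (fun z : ℝ × ℝ => ((rho (b^3) N z.1 : ℝ):ℂ) * ((b:ℂ)^2)⁻¹) := by
        have := rho_cont (b^3) N
        fun_prop
      have h3 : Continuous (fun z : ℝ × ℝ => Complex.exp (zet a z.2 * ((z.1-2*μ)/b^2 : ℝ))) := by
        unfold zet; fun_prop
      exact h2.aestronglyMeasurable.mul (h1.mul h3.aestronglyMeasurable)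
    · apply le_of_eq
      obtain ⟨u, ω⟩ := z
      simp only [Function.uncurry, f, norm_mul, Complex.norm_exp]
      have e5 : (zet a ω * ((u-2*μ)/b^2 : ℝ)).re = a * ((u-2*μ)/b^2) := by
        rw [Complex.re_mul_ofReal, zet_re]
      have e6 : (zet a 0 * (-2*μ/b^2 : ℝ)).re = a * (-2*μ/b^2) := by
        rw [Complex.re_mul_ofReal, zet_re]
      have e7 : (((a/b^2 : ℝ):ℂ) * (u:ℂ)).re = a/b^2*u := by
        rw [Complex.re_ofReal_mul, Complex.ofReal_re]
      rw [e5, e6, e7, show a * ((u-2*μ)/b^2) = a * (-2*μ/b^2) + a/b^2*u by ring, Real.exp_add]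
      ring


noncomputable def eta (t : ℝ) : ℂ := 1 + (t:ℂ)*Complex.I

lemma eta_re (t : ℝ) : (eta t).re = 1 := by simp [eta]

lemma eta_ne (t : ℝ) : eta t ≠ 0 := by
  intro h; have := eta_re t; rw [h] at this; simp at this

lemma eta_norm (t : ℝ) : 1 ≤ ‖eta t‖ := by
  rw [← eta_re t]; exact Complex.re_le_norm _

lemma eta_cube_norm (t : ℝ) : ‖Complex.exp ((eta t)^3/3)‖ = Real.exp (1/3) * Real.exp (-1*t^2) := by
  rw [Complex.norm_exp, ← Real.exp_add]; congr 1
  have : (eta t)^3/3 = (((1-3*t^2)/3 : ℝ) : ℂ) + ((t - t^3/3 : ℝ):ℂ) * Complex.I := by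
    unfold eta
    push_cast
    linear_combination ((t:ℂ)^2 + (t:ℂ)^3/3*Complex.I) * Complex.I_sq
  rw [this, Complex.add_re, Complex.ofReal_re, Complex.re_ofReal_mul]
  simp; ring

lemma eta_cont : Continuous eta := by unfold eta; fun_prop

lemma airy_w_int : Integrable (fun t : ℝ => Complex.exp ((eta t)^3/3)) := by
  have h := (integrable_exp_neg_mul_sq (b := 1) one_pos).const_mul (Real.exp (1/3))
  refine h.mono' ?_ (ae_of_all _ fun t => (eta_cube_norm t).le)
  have := eta_cont
  exact (by fun_prop : Continuous (fun t : ℝ => Complex.exp ((eta t)^3/3))).aestronglyMeasurable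

lemma airy_w_int' : Integrable (fun t : ℝ => Complex.exp ((eta t)^3/3) / eta t) := by
  have := eta_cont
  refine airy_w_int.mono ?_ (ae_of_all _ fun t => ?_)
  · exact (Continuous.div (by fun_prop) eta_cont eta_ne).aestronglyMeasurable
  · rw [norm_div]; exact div_le_self (norm_nonneg _) (eta_norm t)

lemma expu_int (ξ : ℝ) : IntegrableOn (fun u : ℝ => Complex.exp (-(u:ℂ))) (Set.Ioi ξ) := by
  have := integrableOn_exp_mul_complex_Ioi (a := -1) (by simp) ξ
  simpa using this

lemma Ai1_eq (ξ : ℝ) : Ai1 ξ = (1/(2*Real.pi)) * (∫ t : ℝ, Complex.exp ((eta t)^3/3) / eta t * Complex.exp (-(ξ * eta t))).re := by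
  unfold Ai1 AiryR AiryC
  let f : ℝ → ℝ → ℂ := fun u t => Complex.exp ((eta t)^3/3) * Complex.exp (-((u:ℂ) * eta t))
  have hf : Integrable (Function.uncurry f) ((volume.restrict (Set.Ioi ξ)).prod volume) := by
    refine ((expu_int ξ).mul_prod airy_w_int).mono ?_ (ae_of_all _ fun z => ?_)
    · have := eta_cont
      have : Continuous (fun z : ℝ × ℝ => Complex.exp ((eta z.2)^3/3) * Complex.exp (-((z.1:ℂ) * eta z.2))) := by fun_prop
      exact this.aestronglyMeasurable
    · apply le_of_eq
      obtain ⟨u, t⟩ := z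
      simp only [Function.uncurry, f, norm_mul]
      rw [mul_comm]; congr 1
      rw [Complex.norm_exp, Complex.norm_exp]; congr 1
      simp [eta_re]
  have e1 : ∀ u : ℝ, ((1 / (2 * (Real.pi : ℂ))) *
    ∫ t : ℝ, Complex.exp ((1 + (t:ℂ)*Complex.I)^3/3 - (u:ℂ)*(1 + (t:ℂ)*Complex.I))).re = (1/(2*Real.pi)) * (∫ t, f u t).re := by
    intro u
    rw [show (1 / (2 * (Real.pi : ℂ))) = ((1/(2*Real.pi) : ℝ) : ℂ) by push_cast; ring, Complex.re_ofReal_mul]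
    congr 2
    apply integral_congr_ae
    refine ae_of_all _ fun t => ?_
    simp only [f]
    rw [← Complex.exp_add, ← sub_eq_add_neg]; rfl
  simp_rw [e1]
  rw [integral_const_mul]
  congr 1
  have h2 := hf.integral_prod_left
  have e2 : ∫ u in Set.Ioi ξ, (∫ t, f u t).re = (∫ u in Set.Ioi ξ, ∫ t, f u t).re := by
    exact Complex.reCLM.integral_comp_comm h2
  rw [e2, integral_integral_swap hf]
  congr 1
  apply integral_congr_ae
  refine ae_of_all _ fun t => ?_
  simp only [f]
  rw [integral_const_mul]
  have := integral_exp_mul_complex_Ioi (a := -eta t) (by simp [eta_re]) ξ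
  have e3 : ∀ u : ℝ, Complex.exp (-((u:ℂ) * eta t)) = Complex.exp (-eta t * u) := fun u => by congr 1; ring
  simp_rw [e3]
  rw [this, show -eta t * ξ = -(ξ * eta t) by ring]
  have := eta_ne t
  field_simp

lemma Ai_pair_int (g : ℝ → ℝ) (hg : Continuous g) (hs : HasCompactSupport g) (c : ℝ) :
    Integrable (fun z : ℝ × ℝ => (g z.1 : ℂ) * (Complex.exp ((eta z.2)^3/3) / eta z.2 * Complex.exp (-(((c*z.1 : ℝ):ℂ) * eta z.2)))) := by
  have h1 : Integrable (fun w : ℝ => ((g w * Real.exp (-(c*w)) : ℝ):ℂ)) := by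
    apply Continuous.integrable_of_hasCompactSupport
    · fun_prop
    · apply hs.mono
      intro w hw
      simp only [Function.mem_support] at hw ⊢
      intro h; apply hw; simp [h]
  refine (h1.mul_prod airy_w_int').mono ?_ (ae_of_all _ fun z => ?_)
  · have h := eta_cont
    have h3 : Continuous (fun z : ℝ × ℝ => Complex.exp ((eta z.2)^3/3) / eta z.2) :=
      Continuous.div (by fun_prop) (by fun_prop) (fun z => eta_ne _)
    have : Continuous (fun z : ℝ × ℝ => (g z.1 : ℂ) * (Complex.exp ((eta z.2)^3/3) / eta z.2 * Complex.exp (-(((c*z.1 : ℝ):ℂ) * eta z.2)))) := by fun_prop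
    exact this.aestronglyMeasurable
  · apply le_of_eq
    obtain ⟨w, t⟩ := z
    simp only [norm_mul]
    have : ‖Complex.exp (-(((c*w : ℝ):ℂ) * eta t))‖ = Real.exp (-(c*w)) := by
      rw [Complex.norm_exp, Complex.neg_re, Complex.re_ofReal_mul, eta_re, mul_one]
    rw [this, Complex.norm_real, Complex.norm_real, norm_mul, Real.norm_of_nonneg (Real.exp_pos _).le]
    ring

lemma Ai1_pair_eq (g : ℝ → ℝ) (c w : ℝ) : Ai1 (c*w) * g w = (1/(2*Real.pi)) * (∫ t : ℝ, (g w : ℂ) * (Complex.exp ((eta t)^3/3) / eta t * Complex.exp (-(((c*w : ℝ):ℂ) * eta t)))).re := by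
  rw [Ai1_eq, integral_const_mul, Complex.re_ofReal_mul]; ring

lemma Ai1_int (g : ℝ → ℝ) (hg : Continuous g) (hs : HasCompactSupport g) (c : ℝ) :
    Integrable (fun w => Ai1 (c*w) * g w) := by
  simp_rw [Ai1_pair_eq]
  have h := (Ai_pair_int g hg hs c).integral_prod_left
  exact (Complex.reCLM.integrable_comp h).const_mul _

lemma Ai1_pair (g : ℝ → ℝ) (hg : Continuous g) (hs : HasCompactSupport g) (μ : ℝ) (hμ : 0 < μ) (c : ℝ) (hc0 : 0 < c) (hc : 2 * μ * c^3 = 1) :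
    ∫ w, Ai1 (c*w) * g w = (∫ ω, HH g c ω * (Complex.exp (2/3 * μ * (zet c ω)^3) / zet c ω)).re := by
  simp_rw [Ai1_pair_eq]
  have hi := Ai_pair_int g hg hs c
  have h := hi.integral_prod_left
  rw [integral_const_mul]
  have e2 := Complex.reCLM.integral_comp_comm h
  simp only [Complex.reCLM_apply] at e2
  rw [e2, integral_integral_swap (f := fun w t : ℝ => (g w : ℂ) * (Complex.exp ((eta t)^3/3) / eta t * Complex.exp (-(((c*w : ℝ):ℂ) * eta t)))) hi]
  have hcc : (c:ℂ) ≠ 0 := by exact_mod_cast hc0.ne'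
  have hpi : (Real.pi : ℂ) ≠ 0 := by exact_mod_cast Real.pi_ne_zero
  have hpos : 0 < c/(2*Real.pi) := by have := Real.pi_pos; positivity
  have h3 := Measure.integral_comp_mul_left (fun ω => HH g c ω * (Complex.exp (2/3 * μ * (zet c ω)^3) / zet c ω)) (c/(2*Real.pi))
  have hz : ∀ t : ℝ, zet c (c/(2*Real.pi)*t) = c * eta t := by
    intro t; unfold zet eta; push_cast; field_simp
  have e4 : ∀ t : ℝ, ∫ w : ℝ, (g w : ℂ) * (Complex.exp ((eta t)^3/3) / eta t * Complex.exp (-(((c*w : ℝ):ℂ) * eta t))) =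
      c * (HH g c (c/(2*Real.pi)*t) * (Complex.exp (2/3 * μ * (zet c (c/(2*Real.pi)*t))^3) / zet c (c/(2*Real.pi)*t))) := by
    intro t
    rw [HH_eq, hz]
    have e5 : 2/3 * (μ:ℂ) * (c * eta t)^3 = (eta t)^3/3 := by
      have : 2 * (μ:ℂ) * (c:ℂ)^3 = 1 := by exact_mod_cast hc
      linear_combination (eta t)^3/3 * this
    rw [e5]
    have e6 : ∀ w : ℝ, (g w : ℂ) * (Complex.exp ((eta t)^3/3) / eta t * Complex.exp (-(((c*w : ℝ):ℂ) * eta t))) = (Complex.exp ((eta t)^3/3) / eta t) * ((g w : ℂ) * Complex.exp (-(c * eta t * w))) := by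
      intro w
      rw [show -(((c*w : ℝ):ℂ) * eta t) = -(c * eta t * w) by push_cast; ring]; ring
    simp_rw [e6]
    rw [integral_const_mul]
    have := eta_ne t
    field_simp
  simp_rw [e4]
  rw [integral_const_mul, h3, Complex.re_ofReal_mul, Complex.smul_re, abs_of_pos (by positivity)]
  simp only [smul_eq_mul]
  have := Real.pi_pos
  field_simp


lemma radial (Φ : ℝ → ℂ) : ∫ z : ℝ × ℝ, Φ (z.1^2+z.2^2) = (Real.pi : ℂ) * ∫ u in Set.Ioi (0:ℝ), Φ u := by
  rw [← integral_comp_polarCoord_symm]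
  have e : ∀ p : ℝ × ℝ, p.1 • Φ ((polarCoord.symm p).1^2 + (polarCoord.symm p).2^2) = ((p.1:ℂ) * Φ (p.1^2)) * (fun _ : ℝ => (1:ℂ)) p.2 := by
    intro p
    have : (polarCoord.symm p).1^2 + (polarCoord.symm p).2^2 = p.1^2 := by
      simp only [polarCoord_symm_apply]
      linear_combination p.1^2 * Real.sin_sq_add_cos_sq p.2
    rw [this, Complex.real_smul, mul_one]
  simp_rw [e]
  have ht : polarCoord.target = Set.Ioi (0:ℝ) ×ˢ Set.Ioo (-Real.pi) Real.pi := rfl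
  rw [ht, Measure.volume_eq_prod, setIntegral_prod_mul (fun r : ℝ => (r:ℂ) * Φ (r^2)) (fun _ : ℝ => (1:ℂ))]
  have h := integral_comp_rpow_Ioi Φ (p := 2) (by norm_num)
  rw [← h]
  have e2 : ∀ r ∈ Set.Ioi (0:ℝ), (|(2:ℝ)| * r^((2:ℝ)-1)) • Φ (r^(2:ℝ)) = 2 * ((r:ℂ) * Φ (r^2)) := by
    intro r _
    rw [show (2:ℝ)-1 = 1 by norm_num, Real.rpow_one, Complex.real_smul]
    simp; ring
  rw [setIntegral_congr_fun measurableSet_Ioi e2, integral_const_mul]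
  have hp := Real.pi_pos
  simp
  rw [max_eq_left (by linarith)]
  push_cast; ring

lemma chi_arg (μ : ℝ) (hμ : 0 < μ) (N : ℕ) (hN : 0 < N) (v : ℝ) :
    (2*(N:ℝ)) ^ ((2:ℝ)/3) * v / (2*μ) = (2*μ)^(-(1:ℝ)/3) * (v / (bN μ N)^2) := by
  have hN' : (0:ℝ) < N := by exact_mod_cast hN
  have hb := bN_pos μ hμ N hN
  have h1 : (2*(N:ℝ)) ^ ((2:ℝ)/3) * (bN μ N)^2 = (2*μ)^((2:ℝ)/3) := by
    unfold bN
    rw [← Real.rpow_natCast, ← Real.rpow_mul (by positivity), show (1:ℝ)/3 * (2:ℕ) = 2/3 by norm_num,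
      ← Real.mul_rpow (by positivity) (by positivity)]
    congr 1; field_simp
  have h2 : (2*μ)^((2:ℝ)/3) = (2*μ)^(-(1:ℝ)/3) * (2*μ) := by
    nth_rw 3 [← Real.rpow_one (2*μ)]
    rw [← Real.rpow_add (by positivity)]; norm_num
  rw [h2] at h1
  clear h2
  generalize (2*μ)^(-(1:ℝ)/3) = k at h1 ⊢
  field_simp
  linear_combination v * h1

lemma bN_sq (μ : ℝ) (hμ : 0 < μ) (N : ℕ) : (μ/N)^((2:ℝ)/3) = (bN μ N)^2 := by
  unfold bN
  rw [← Real.rpow_natCast, ← Real.rpow_mul (by positivity)]; norm_num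

lemma bN_sq_inv (μ : ℝ) (hμ : 0 < μ) (N : ℕ) : (μ/N)^(-(2:ℝ)/3) = ((bN μ N)^2)⁻¹ := by
  rw [← bN_sq μ hμ, ← Real.rpow_neg (by positivity)]; congr 1; ring

lemma final_eq (μ : ℝ) (hμ : 0 < μ) (g : ℝ → ℝ)
    (hg : ContDiff ℝ (⊤ : ℕ∞) g) (hs : HasCompactSupport g) (c : ℝ) (hcdef : c = (2*μ)^(-(1:ℝ)/3)) (hc0 : 0 < c)
    (N : ℕ) (hN : 0 < N) (hab : c * bN μ N < 1) (R : ℝ) (hR : ∀ w, w ≤ -R → g w = 0) (hbR : R * (bN μ N)^2 ≤ 2*μ) :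
    ∫ z : ℝ × ℝ,
        (sigmaP (μ / N) N z.1 z.2 - ((chiDN μ N z.1 z.2 : ℝ) : ℂ)) *
          ((((μ / N) ^ (-(2:ℝ)/3) *
            g ((z.1^2 + z.2^2 - 2*μ) / (μ / N) ^ ((2:ℝ)/3)) : ℝ)) : ℂ) =
    (Real.pi : ℂ) * ((((∫ ω, HH g c ω * JN μ N (zet c ω)).re : ℝ) : ℂ) - ((∫ w, Ai1 (c*w) * g w : ℝ) : ℂ)) := by
  have hN' : (0:ℝ) < N := by exact_mod_cast hN
  have hb := bN_pos μ hμ N hN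
  have hh0 : 0 < μ/N := by positivity
  rw [← I_J μ hμ g hg hs c hc0 N hN hab]
  rw [bN_sq_inv μ hμ, bN_sq μ hμ]
  set b := bN μ N with hbd
  have e1 : ∀ z : ℝ × ℝ, (sigmaP (μ / N) N z.1 z.2 - ((chiDN μ N z.1 z.2 : ℝ) : ℂ)) *
          (((b^2)⁻¹ * g ((z.1^2 + z.2^2 - 2*μ) / b^2) : ℝ) : ℂ) =
      (fun u : ℝ => (((rho (μ/N) N u * ((b^2)⁻¹ * g ((u - 2*μ) / b^2)) - (b^2)⁻¹ * (Ai1 (c * ((u - 2*μ) / b^2)) * g ((u - 2*μ) / b^2)) : ℝ)) : ℂ)) (z.1^2+z.2^2) := by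
    intro z
    rw [sigmaP_eq _ hh0, chiDN, chi_arg μ hμ N hN, ← hcdef, ← hbd]
    push_cast; ring
  refine (integral_congr_ae (ae_of_all _ e1)).trans ?_
  refine (radial (fun u : ℝ => (((rho (μ/N) N u * ((b^2)⁻¹ * g ((u - 2*μ) / b^2)) - (b^2)⁻¹ * (Ai1 (c * ((u - 2*μ) / b^2)) * g ((u - 2*μ) / b^2)) : ℝ)) : ℂ))).trans ?_
  congr 1
  have hgc := hg.continuous
  have i1 : IntegrableOn (fun u => rho (μ/N) N u * ((b^2)⁻¹ * g ((u - 2*μ) / b^2))) (Set.Ioi 0) := by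
    obtain ⟨C, hC⟩ := hs.exists_bound_of_continuous hgc
    have h1 := (rho_int (μ/N) hh0 N 0 (by simp; positivity)).norm.mul_const ((b^2)⁻¹ * C)
    refine Integrable.mono' h1 ?_ (ae_of_all _ fun u => ?_)
    · have := rho_cont (μ/N) N
      exact (by fun_prop : Continuous (fun u => rho (μ/N) N u * ((b^2)⁻¹ * g ((u - 2*μ) / b^2)))).aestronglyMeasurable
    · simp only [norm_mul, zero_mul, Complex.exp_zero, norm_one, mul_one, Complex.norm_real]
      rw [Real.norm_of_nonneg (show 0 ≤ (b^2)⁻¹ by positivity)]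
      gcongr
      exact hC _
  have i2 : Integrable (fun u => (b^2)⁻¹ * (Ai1 (c * ((u - 2*μ) / b^2)) * g ((u - 2*μ) / b^2))) := by
    have := ((Ai1_int g hgc hs c).comp_div (R := b^2) (by positivity)).comp_sub_right (2*μ)
    exact this.const_mul _
  rw [integral_complex_ofReal, integral_sub i1 i2.integrableOn]
  push_cast
  congr 1
  · have e3 : (∫ u in Set.Ioi (0:ℝ), ((rho (μ/N) N u : ℝ) : ℂ) * (((b:ℂ)^2)⁻¹ * ((g ((u - 2*μ)/b^2) : ℝ) : ℂ))) =
        ∫ u in Set.Ioi (0:ℝ), ((rho (μ/N) N u * ((b^2)⁻¹ * g ((u - 2*μ) / b^2)) : ℝ) : ℂ) := by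
      congr 1; funext u; push_cast; rfl
    rw [e3, integral_complex_ofReal, Complex.ofReal_re]
  · congr 1
    rw [setIntegral_eq_integral_of_forall_compl_eq_zero]
    · rw [integral_const_mul, integral_sub_right_eq_self (fun u => Ai1 (c * (u / b^2)) * g (u / b^2)) (2*μ),
        Measure.integral_comp_div (fun w => Ai1 (c*w) * g w) (b^2), abs_of_pos (by positivity), smul_eq_mul]
      field_simp
    · intro u hu
      have hu : u ≤ 0 := by simpa using hu
      rw [hR]; · ring
      rw [div_le_iff₀ (by positivity)]
      linarith

/-- Weak asymptotics of `σ_{P_{<N}}` at the boundary of the disk: tested against the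
rescaled test functions `ℏ^{-2/3} g((x²+p²-2μ)/ℏ^{2/3})` with `g ∈ C_c^∞(ℝ)`,
the difference with the Airy-smoothed indicator `χ_D^{(N)}` tends to zero. -/
theorem edge_asymptotics_sigmaP (μ : ℝ) (hμ : 0 < μ) (g : ℝ → ℝ)
    (hg_smooth : ContDiff ℝ (⊤ : ℕ∞) g) (hg_supp : HasCompactSupport g) :
    Tendsto (fun N : ℕ =>
      ∫ z : ℝ × ℝ,
        (sigmaP (μ / N) N z.1 z.2 - ((chiDN μ N z.1 z.2 : ℝ) : ℂ)) *
          ((((μ / N) ^ (-(2:ℝ)/3) *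
            g ((z.1^2 + z.2^2 - 2*μ) / (μ / N) ^ ((2:ℝ)/3)) : ℝ)) : ℂ))
      atTop (nhds 0) := by
  set c : ℝ := (2*μ)^(-(1:ℝ)/3) with hc
  have hc0 : 0 < c := by positivity
  have hc3 : 2 * μ * c^3 = 1 := by
    rw [hc, ← Real.rpow_natCast, ← Real.rpow_mul (by positivity), show -(1:ℝ)/3 * (3:ℕ) = -1 by norm_num, Real.rpow_neg_one]
    field_simp
  obtain ⟨R, hR⟩ : ∃ R : ℝ, ∀ w, w ≤ -R → g w = 0 := by
    obtain ⟨r, hr⟩ := hg_supp.isCompact.isBounded.subset_closedBall 0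
    refine ⟨r + 1, fun w hw => ?_⟩
    by_contra h
    have := hr (subset_tsupport g h)
    rw [Metric.mem_closedBall, dist_zero_right, Real.norm_eq_abs, abs_le] at this
    linarith [this.1]
  have hlim := limit_J μ hμ c hc0 _ (HH_int g hg_smooth hg_supp c)
  have hre := (Complex.continuous_re.tendsto _).comp hlim
  rw [← Ai1_pair g hg_smooth.continuous hg_supp μ hμ c hc0 hc3] at hre
  have hco := (Complex.continuous_ofReal.tendsto _).comp hre
  have hfin := (hco.sub_const ((∫ w, Ai1 (c*w) * g w : ℝ) : ℂ)).const_mul (Real.pi : ℂ)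
  rw [sub_self, mul_zero] at hfin
  refine hfin.congr' ?_
  have h1 : Tendsto (fun N => c * bN μ N) atTop (nhds 0) := by simpa using (bN_tendsto μ).const_mul c
  have h2 : Tendsto (fun N => R * (bN μ N)^2) atTop (nhds 0) := by simpa using ((bN_tendsto μ).pow 2).const_mul R
  filter_upwards [h1.eventually_lt_const one_pos, h2.eventually_le_const (show 0 < 2*μ by positivity), eventually_gt_atTop 0] with N hN1 hN2 hN
  rw [final_eq μ hμ g hg_smooth hg_supp c hc hc0 N hN hN1 R hR hN2]
  rfl
end

section
/- Let μ > 0 and for each integer N ≥ 1 set ℏ = ℏ_N := μ/N. Then for every point (x,p) ∈ ℝ² in the classically forbidden region, i.e. with x² + p² ≥ 2μ, one has the pointwise limit lim_{N→∞} [σ_{H_N}^{ℏ_N}(x,p) − p·χ_D^{(N)}(x,p)] = 0. -/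
open MeasureTheory Filter

noncomputable def zG (k : ℕ) (u : ℝ) : ℝ := iteratedDeriv k (fun t : ℝ => Real.exp (-t^2)) u

lemma zG_hasDeriv (k : ℕ) (u : ℝ) : HasDerivAt (zG k) (zG (k+1) u) u := by
  have h : ContDiff ℝ ⊤ (fun t : ℝ => Real.exp (-t^2)) := by fun_prop
  have h2 : Differentiable ℝ (iteratedDeriv k (fun t : ℝ => Real.exp (-t^2))) :=
    h.differentiable_iteratedDeriv k (by exact_mod_cast WithTop.coe_lt_top _)
  have := (h2 u).hasDerivAt
  unfold zG
  rw [iteratedDeriv_succ]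
  exact this

lemma zG_zero (u : ℝ) : zG 0 u = Real.exp (-u^2) := by simp [zG]

lemma zG_one (u : ℝ) : zG 1 u = -2 * u * zG 0 u := by
  have h := zG_hasDeriv 0 u
  have h2 : HasDerivAt (zG 0) (Real.exp (-u^2) * (-(2*u))) u := by
    have : zG 0 = fun t : ℝ => Real.exp (-t^2) := by funext t; exact zG_zero t
    rw [this]
    have := ((hasDerivAt_pow 2 u).neg).exp
    simpa using this
  rw [h.unique h2, zG_zero]; ring

lemma zG_rec (k : ℕ) : ∀ u : ℝ, zG (k+2) u = -2 * u * zG (k+1) u - 2 * (k+1) * zG k u := by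
  induction k with
  | zero =>
    intro u
    have h := zG_hasDeriv 1 u
    have h2 : HasDerivAt (zG 1) (-2 * zG 0 u + (-2 * u) * zG 1 u) u := by
      have : zG 1 = fun t : ℝ => (-2 * t) * zG 0 t := by funext t; exact zG_one t
      conv => arg 1; rw [this]
      have := ((hasDerivAt_id u).const_mul (-2)).mul (zG_hasDeriv 0 u)
      refine this.congr_deriv ?_
      simp
    rw [h.unique h2]; push_cast; ring
  | succ k ih =>
    intro u
    have h := zG_hasDeriv (k+2) u
    have h2 : HasDerivAt (zG (k+2))
        ((-2 * zG (k+1) u + (-2 * u) * zG (k+2) u) - 2*(k+1) * zG (k+1) u) u := by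
      have : zG (k+2) = fun t : ℝ => (-2 * t) * zG (k+1) t - 2 * (k+1) * zG k t := by
        funext t; exact ih t
      conv => arg 1; rw [this]
      have := (((hasDerivAt_id u).const_mul (-2)).mul (zG_hasDeriv (k+1) u)).sub
        ((zG_hasDeriv k u).const_mul (2*((k:ℝ)+1)))
      refine this.congr_deriv ?_
      simp
    rw [h.unique h2]; push_cast; ring

noncomputable def zphi (k : ℕ) (u : ℝ) : ℝ := (-1)^k * Real.exp (u^2/2) * zG k u

lemma zphi_hasDeriv (k : ℕ) (u : ℝ) : HasDerivAt (zphi k) (u * zphi k u - zphi (k+1) u) u := by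
  have h1 : HasDerivAt (fun u : ℝ => Real.exp (u^2/2)) (Real.exp (u^2/2) * u) u := by
    have := ((hasDerivAt_pow 2 u).div_const 2).exp
    simpa using this
  have := (h1.const_mul ((-1)^k)).mul (zG_hasDeriv k u)
  refine this.congr_deriv ?_
  simp only [zphi, pow_succ]; ring

lemma zphi_rec (k : ℕ) (u : ℝ) : zphi (k+1) u = 2 * u * zphi k u - 2 * k * zphi (k-1) u := by
  cases k with
  | zero => simp [zphi, zG_one]; ring
  | succ k => simp only [zphi, zG_rec, pow_succ, Nat.add_sub_cancel]; push_cast; ring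

lemma zphi_hasDeriv' (k : ℕ) (u : ℝ) :
    HasDerivAt (zphi k) (-u * zphi k u + 2 * k * zphi (k-1) u) u := by
  refine (zphi_hasDeriv k u).congr_deriv ?_
  rw [zphi_rec]; ring

lemma zphi_poly (k : ℕ) : ∃ q : Polynomial ℝ, ∀ u, zphi k u = q.eval u * Real.exp (-u^2/2) := by
  induction k using Nat.strong_induction_on with
  | _ k ih =>
    cases k with
    | zero =>
      refine ⟨1, fun u => ?_⟩
      simp only [zphi, zG_zero, pow_zero, one_mul, Polynomial.eval_one]
      rw [← Real.exp_add]; ring_nf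
    | succ k =>
      obtain ⟨q, hq⟩ := ih k (by omega)
      obtain ⟨q', hq'⟩ := ih (k-1) (by omega)
      refine ⟨2 * Polynomial.X * q - Polynomial.C (2 * (k:ℝ)) * q', fun u => ?_⟩
      rw [zphi_rec, hq, hq']
      simp only [Polynomial.eval_sub, Polynomial.eval_mul, Polynomial.eval_X, Polynomial.eval_C,
        Polynomial.eval_ofNat]
      ring

noncomputable def zB (X P : ℝ) (m n : ℕ) (y : ℝ) : ℂ :=
  ((zphi m (X - y/2) * zphi n (X + y/2) : ℝ) : ℂ) * Complex.exp (Complex.I * P * y)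

lemma zpoly_int (q : Polynomial ℝ) : Integrable (fun y : ℝ => q.eval y * Real.exp (-(1/4) * y^2)) := by
  induction q using Polynomial.induction_on' with
  | add p q hp hq =>
    simp only [Polynomial.eval_add, add_mul]; exact hp.add hq
  | monomial n a =>
    have := (integrable_rpow_mul_exp_neg_mul_sq (b := 1/4) (by norm_num) (s := n)
      (by have : (0:ℝ) ≤ n := n.cast_nonneg
          linarith)).const_mul a
    simpa [Polynomial.eval_monomial, mul_assoc] using this

lemma zB_int (X P : ℝ) (m n : ℕ) : Integrable (zB X P m n) := by
  obtain ⟨q, hq⟩ := zphi_poly m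
  obtain ⟨q', hq'⟩ := zphi_poly n
  have h1 : Integrable (fun y : ℝ => zphi m (X - y/2) * zphi n (X + y/2)) := by
    have := (zpoly_int ((q.comp (Polynomial.C X - Polynomial.C (1/2) * Polynomial.X)) *
      (q'.comp (Polynomial.C X + Polynomial.C (1/2) * Polynomial.X)))).mul_const (Real.exp (-X^2))
    refine this.congr (Eventually.of_forall fun y => ?_)
    simp only [hq, hq', Polynomial.eval_mul, Polynomial.eval_comp, Polynomial.eval_sub,
      Polynomial.eval_add, Polynomial.eval_C, Polynomial.eval_X]
    have e : Real.exp (-(1/4) * y^2) * Real.exp (-X^2) =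
      Real.exp (-(X - y/2)^2/2) * Real.exp (-(X + y/2)^2/2) := by
      rw [← Real.exp_add, ← Real.exp_add]; congr 1; ring
    rw [mul_assoc, e]
    rw [show (1/2) * y = y/2 by ring]; ring
  have h2 := h1.ofReal (𝕜 := ℂ)
  refine Integrable.mul_bdd (c := 1) h2 ?_ ?_
  · exact Continuous.aestronglyMeasurable (by fun_prop)
  · refine Eventually.of_forall fun y => ?_
    rw [Complex.norm_exp]; simp

lemma zB_hasDeriv (X P : ℝ) (m n : ℕ) (y a b : ℝ) (ha : HasDerivAt (zphi m) a (X - y/2))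
    (hb : HasDerivAt (zphi n) b (X + y/2)) :
    HasDerivAt (zB X P m n) (((-a/2 * zphi n (X + y/2) + zphi m (X - y/2) * (b/2) : ℝ) : ℂ) *
      Complex.exp (Complex.I * P * y) + Complex.I * P * zB X P m n y) y := by
  have i1 : HasDerivAt (fun y : ℝ => X - y/2) (-1/2) y := by
    have := ((hasDerivAt_id y).div_const 2).const_sub X
    simpa [neg_div] using this
  have i2 : HasDerivAt (fun y : ℝ => X + y/2) (1/2) y := by
    have := ((hasDerivAt_id y).div_const 2).const_add X
    simpa using this
  have h1 := (HasDerivAt.comp y ha i1).mul (HasDerivAt.comp y hb i2)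
  have h2 := h1.ofReal_comp
  have h3 : HasDerivAt (fun y : ℝ => Complex.exp (Complex.I * P * y))
      (Complex.exp (Complex.I * P * y) * (Complex.I * P)) y := by
    have := (((hasDerivAt_id y).ofReal_comp).const_mul (Complex.I * P)).cexp
    simpa using this
  have := h2.mul h3
  refine this.congr_deriv ?_
  simp only [zB, Function.comp, Pi.mul_apply]; push_cast; ring

noncomputable def zW (X P : ℝ) (m n : ℕ) : ℂ := ∫ y, zB X P m n y

lemma zW_left (X P : ℝ) (m n : ℕ) :
    zW X P (m+1) n = 2 * (X - Complex.I * P) * zW X P m n - 2 * n * zW X P m (n-1) := by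
  have hd : ∀ y, HasDerivAt (zB X P m n) ((1/2) * zB X P (m+1) n y
      + (-X + Complex.I * P) * zB X P m n y + n * zB X P m (n-1) y) y := by
    intro y
    refine (zB_hasDeriv X P m n y _ _ (zphi_hasDeriv m _) (zphi_hasDeriv' n _)).congr_deriv ?_
    simp only [zB]; push_cast; ring
  have i1 := (zB_int X P (m+1) n).const_mul (1/2)
  have i2 := (zB_int X P m n).const_mul (-X + Complex.I * P)
  have i3 := (zB_int X P m (n-1)).const_mul (n:ℂ)
  have := integral_eq_zero_of_hasDerivAt_of_integrable hd ((i1.add i2).add i3) (zB_int X P m n)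
  erw [integral_add (i1.add i2) i3, integral_add i1 i2] at this
  simp only [integral_const_mul] at this
  unfold zW
  linear_combination 2 * this

lemma zW_right (X P : ℝ) (m n : ℕ) :
    zW X P m (n+1) = 2 * (X + Complex.I * P) * zW X P m n - 2 * m * zW X P (m-1) n := by
  have hd : ∀ y, HasDerivAt (zB X P m n) ((-1/2) * zB X P m (n+1) y
      + (X + Complex.I * P) * zB X P m n y + (-m) * zB X P (m-1) n y) y := by
    intro y
    refine (zB_hasDeriv X P m n y _ _ (zphi_hasDeriv' m _) (zphi_hasDeriv n _)).congr_deriv ?_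
    simp only [zB]; push_cast; ring
  have i1 := (zB_int X P m (n+1)).const_mul (-1/2)
  have i2 := (zB_int X P m n).const_mul (X + Complex.I * P)
  have i3 := (zB_int X P (m-1) n).const_mul (-m:ℂ)
  have := integral_eq_zero_of_hasDerivAt_of_integrable hd ((i1.add i2).add i3) (zB_int X P m n)
  erw [integral_add (i1.add i2) i3, integral_add i1 i2] at this
  simp only [integral_const_mul] at this
  unfold zW
  linear_combination -2 * this

lemma zW_zero (X P : ℝ) : zW X P 0 0 = 2 * Real.sqrt Real.pi * Real.exp (-(X^2+P^2)) := by
  have h := fourierIntegral_gaussian (b := 1/4) (by norm_num) (P:ℂ)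
  have e : ∀ y, zB X P 0 0 y = Complex.exp (-(X:ℂ)^2) *
      (Complex.exp (Complex.I * P * y) * Complex.exp (-(1/4) * (y:ℂ)^2)) := by
    intro y
    simp only [zB, zphi, zG_zero, pow_zero, one_mul]
    rw [← Real.exp_add, ← Real.exp_add, ← Real.exp_add]
    push_cast
    rw [← Complex.exp_add, ← Complex.exp_add, ← Complex.exp_add]
    congr 1; ring
  unfold zW
  simp only [e]
  rw [integral_const_mul, h]
  have : ((Real.pi:ℂ) / (1/4)) ^ (1/2:ℂ) = 2 * (Real.sqrt Real.pi : ℂ) := by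
    have h4 : (Real.pi:ℂ) / (1/4) = ((4 * Real.pi : ℝ) : ℂ) := by push_cast; ring
    rw [h4, show (1/2:ℂ) = ((1/2:ℝ):ℂ) by push_cast; rfl, ← Complex.ofReal_cpow (by positivity),
      ← Real.sqrt_eq_rpow, Real.sqrt_mul (by norm_num), show (4:ℝ) = 2^2 by norm_num,
      Real.sqrt_sq (by norm_num)]
    push_cast; rfl
  rw [this]
  push_cast
  rw [mul_comm, mul_assoc, ← Complex.exp_add]
  congr 2; ring

lemma zW_eval (X P : ℝ) (d e : ℕ → ℂ) (hd0 : d 0 = 1) (he0 : e 0 = 1)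
    (h1 : ∀ j, e (j+1) + e j = d (j+1))
    (h2 : ∀ j : ℕ, ((j:ℂ)+1) * (d (j+1) + d j) = (2 * (X^2+P^2) : ℝ) * e j) (j : ℕ) :
    zW X P j j = zW X P 0 0 * (2^j * j.factorial * d j) ∧
    zW X P (j+1) j = zW X P 0 0 * (2^j * j.factorial * (2 * (X - Complex.I * P) * e j)) ∧
    zW X P j (j+1) = zW X P 0 0 * (2^j * j.factorial * (2 * (X + Complex.I * P) * e j)) := by
  induction j with
  | zero =>
    refine ⟨by simp [hd0], ?_, ?_⟩
    · rw [zW_left]; simp [he0]; ring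
    · rw [zW_right]; simp [he0]; ring
  | succ j ih =>
    obtain ⟨a, b, c⟩ := ih
    have a' : zW X P (j+1) (j+1) = zW X P 0 0 * (2^(j+1) * (j+1).factorial * d (j+1)) := by
      rw [zW_right, Nat.add_sub_cancel, a, b, Nat.factorial_succ]
      have := h2 j
      push_cast at this ⊢
      have hI := Complex.I_sq
      linear_combination (-2 * 2^j * j.factorial * zW X P 0 0) * this - zW X P 0 0 * 2^j * j.factorial * 4 * P^2 * e j * hI
    refine ⟨a', ?_, ?_⟩
    · rw [zW_left, a', Nat.add_sub_cancel, b, ← h1, Nat.factorial_succ]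
      push_cast; ring
    · rw [zW_right, a', Nat.add_sub_cancel, c, ← h1, Nat.factorial_succ]
      push_cast; ring

lemma zpsi_eq (h : ℝ) (hh : 0 < h) (k : ℕ) (u : ℝ) : psiH h k u =
    (Real.sqrt (Real.sqrt Real.pi * 2^k * (Nat.factorial k) * Real.sqrt h))⁻¹ *
      zphi k (u / Real.sqrt h) := by
  unfold psiH hermiteH zphi zG
  have e : Real.exp (-u^2/(2*h)) * Real.exp ((u / Real.sqrt h)^2) =
      Real.exp ((u / Real.sqrt h)^2/2) := by
    rw [← Real.exp_add, div_pow, Real.sq_sqrt hh.le]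
    congr 1; field_simp; ring
  rw [← e]; ring

lemma zcoef (s : ℝ) (hs : 0 < s) (j : ℕ) :
    Real.sqrt ((j:ℝ)+1) * ((Real.sqrt (Real.sqrt Real.pi * 2^(j+1) * (Nat.factorial (j+1)) * s))⁻¹
      * (Real.sqrt (Real.sqrt Real.pi * 2^j * (Nat.factorial j) * s))⁻¹) =
    (Real.sqrt 2 * (Real.sqrt Real.pi * 2^j * (Nat.factorial j) * s))⁻¹ := by
  have hA : 0 < Real.sqrt Real.pi * 2^j * (Nat.factorial j) * s := by positivity
  set A := Real.sqrt Real.pi * 2^j * (Nat.factorial j) * s with hAdef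
  have e : Real.sqrt Real.pi * 2^(j+1) * (Nat.factorial (j+1)) * s = ((j:ℝ)+1) * (2 * A) := by
    rw [hAdef, Nat.factorial_succ]; push_cast; ring
  rw [e, Real.sqrt_mul (by positivity), Real.sqrt_mul (by positivity)]
  have h1 : 0 < Real.sqrt ((j:ℝ)+1) := by positivity
  have h2 : 0 < Real.sqrt A := by positivity
  have h3 := Real.mul_self_sqrt hA.le
  rw [mul_inv, mul_inv, mul_inv]
  field_simp
  rw [sq, h3]

lemma zsigma (h : ℝ) (hh : 0 < h) (N : ℕ) (x p : ℝ) (d e : ℕ → ℂ) (hd0 : d 0 = 1) (he0 : e 0 = 1)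
    (h1 : ∀ j, e (j+1) + e j = d (j+1))
    (h2 : ∀ j : ℕ, ((j:ℂ)+1) * (d (j+1) + d j) = (2 * (x^2+p^2) / h : ℝ) * e j) :
    sigmaH h N x p = 4 * p * ∑ j ∈ Finset.range (N-1), e j * Real.exp (-((x^2+p^2)/h)) := by
  set s := Real.sqrt h with hsdef
  have hs : 0 < s := Real.sqrt_pos.2 hh
  have hss : s^2 = h := Real.sq_sqrt hh.le
  set X := x / s with hX
  set P := p / s with hP
  have hXP : X^2 + P^2 = (x^2+p^2)/h := by rw [hX, hP, div_pow, div_pow, hss]; ring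
  have key := zW_eval X P d e hd0 he0 h1 (by
    intro j; rw [h2 j, hXP, mul_div_assoc])
  have int_eq : ∀ y : ℝ, (h : ℂ) * KerQ h N (x - h*y/2) (x + h*y/2) *
      Complex.exp (Complex.I * (p:ℂ) * (y:ℂ)) =
      ∑ j ∈ Finset.range (N-1), (h * Complex.I * (Real.sqrt (h/2) : ℂ) *
        (((Real.sqrt 2 * (Real.sqrt Real.pi * 2^j * (Nat.factorial j) * s))⁻¹ : ℝ) : ℂ)) *
        (zB X P (j+1) j (s * y) - zB X P j (j+1) (s*y)) := by
    intro y
    unfold KerQ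
    rw [Finset.mul_sum, Finset.mul_sum, Finset.sum_mul]
    refine Finset.sum_congr rfl fun j _ => ?_
    have u1 : (x - h*y/2)/s = X - s*y/2 := by rw [hX, ← hss]; field_simp
    have u2 : (x + h*y/2)/s = X + s*y/2 := by rw [hX, ← hss]; field_simp
    have u3 : (Complex.I * (p:ℂ) * (y:ℂ)) = Complex.I * P * ((s * y : ℝ) : ℂ) := by
      rw [hP]; push_cast
      have : (s:ℂ) ≠ 0 := by exact_mod_cast hs.ne'
      field_simp
    rw [zpsi_eq h hh, zpsi_eq h hh, zpsi_eq h hh, zpsi_eq h hh, ← hsdef, u1, u2, ← zcoef s hs, u3]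
    simp only [zB]
    push_cast
    ring
  unfold sigmaH
  simp only [int_eq]
  have hi : ∀ m n, Integrable (fun y => zB X P m n (s*y)) := fun m n =>
    (zB_int X P m n).comp_mul_left' hs.ne'
  rw [integral_finsetSum]
  swap
  · intro j _
    exact ((hi _ _).sub (hi _ _)).const_mul _
  rw [Finset.mul_sum]
  refine Finset.sum_congr rfl fun j _ => ?_
  rw [integral_const_mul, integral_sub (hi _ _) (hi _ _), Measure.integral_comp_mul_left (zB X P (j+1) j),
    Measure.integral_comp_mul_left (zB X P j (j+1))]
  change _ * (_ • zW X P (j+1) j - _ • zW X P j (j+1)) = _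
  rw [(key j).2.1, (key j).2.2, zW_zero, hXP, abs_of_pos (inv_pos.2 hs)]
  have hq : Real.sqrt (h/2) = s / Real.sqrt 2 := by rw [Real.sqrt_div hh.le]
  have hp : (p:ℂ) = P * s := by rw [← Complex.ofReal_mul, hP, div_mul_cancel₀ _ hs.ne']
  rw [hq, hp, Complex.real_smul, Complex.real_smul]
  have h2' : (Real.sqrt 2 : ℂ)^2 = 2 := by
    exact_mod_cast Real.sq_sqrt (by norm_num : (0:ℝ) ≤ 2)
  have hh' : (h:ℂ) = (s:ℂ)^2 := by exact_mod_cast hss.symm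
  have n1 : (s:ℂ) ≠ 0 := by exact_mod_cast hs.ne'
  have n2 : (Real.sqrt 2 : ℂ) ≠ 0 := by
    have : Real.sqrt 2 ≠ 0 := by positivity
    exact_mod_cast this
  have n3 : (Real.sqrt Real.pi : ℂ) ≠ 0 := by
    have : Real.sqrt Real.pi ≠ 0 := by positivity
    exact_mod_cast this
  have n4 : (j.factorial : ℂ) ≠ 0 := by exact_mod_cast j.factorial_ne_zero
  push_cast
  rw [hh']
  field_simp
  rw [h2']
  ring_nf
  simp only [Complex.I_sq]
  ring

noncomputable def zc (r : ℝ) (n : ℕ) (f : ℂ → ℂ) : ℂ :=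
  (2 * Real.pi * Complex.I)⁻¹ * ∮ z in C(0, r), (z^(n+1))⁻¹ * f z

lemma zc_int {r : ℝ} (hr : 0 < r) (n : ℕ) {f : ℂ → ℂ}
    (hf : ContinuousOn f (Metric.sphere 0 r)) :
    CircleIntegrable (fun z => (z^(n+1))⁻¹ * f z) 0 r := by
  refine ContinuousOn.circleIntegrable hr.le ?_
  refine ContinuousOn.mul (ContinuousOn.inv₀ (by fun_prop) ?_) hf
  intro z hz
  have : ‖z‖ = r := by simpa using hz
  exact pow_ne_zero _ (norm_pos_iff.1 (this ▸ hr))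

lemma zc_congr {r : ℝ} (hr : 0 < r) (n : ℕ) {f g : ℂ → ℂ}
    (h : ∀ z, ‖z‖ = r → f z = g z) : zc r n f = zc r n g := by
  unfold zc
  congr 1
  refine circleIntegral.integral_congr hr.le fun z hz => ?_
  rw [h z (by simpa using hz)]

lemma zc_add {r : ℝ} (hr : 0 < r) (n : ℕ) {f g : ℂ → ℂ}
    (hf : ContinuousOn f (Metric.sphere 0 r)) (hg : ContinuousOn g (Metric.sphere 0 r)) :
    zc r n (fun z => f z + g z) = zc r n f + zc r n g := by
  unfold zc
  rw [← mul_add, ← circleIntegral.integral_add (zc_int hr n hf) (zc_int hr n hg)]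
  simp only [mul_add]

lemma zc_const_mul (r : ℝ) (n : ℕ) (a : ℂ) (f : ℂ → ℂ) :
    zc r n (fun z => a * f z) = a * zc r n f := by
  unfold zc
  have : (∮ z in C(0, r), (z^(n+1))⁻¹ * (a * f z)) = a * ∮ z in C(0, r), (z^(n+1))⁻¹ * f z := by
    rw [← circleIntegral.integral_const_mul]
    congr 1; funext z; ring
  rw [this]; ring

lemma zc_shift {r : ℝ} (hr : 0 < r) (n : ℕ) (f : ℂ → ℂ) :
    zc r (n+1) (fun z => z * f z) = zc r n f := by
  unfold zc
  congr 1
  refine circleIntegral.integral_congr hr.le fun z hz => ?_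
  have : ‖z‖ = r := by simpa using hz
  have hz0 : z ≠ 0 := norm_pos_iff.1 (this ▸ hr)
  simp only
  field_simp
  ring

lemma zc_zero {r : ℝ} (hr : 0 < r) {f : ℂ → ℂ}
    (hf : DifferentiableOn ℂ f (Metric.closedBall 0 r)) : zc r 0 f = f 0 := by
  have := hf.circleIntegral_sub_inv_smul (w := 0) (by simpa using hr)
  unfold zc
  simp only [sub_zero, smul_eq_mul] at this
  simp only [zero_add, pow_one, this]
  have : (2 * Real.pi * Complex.I : ℂ) ≠ 0 := Complex.two_pi_I_ne_zero
  field_simp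

lemma zc_deriv {r : ℝ} (hr : 0 < r) (n : ℕ) {f f' : ℂ → ℂ}
    (hf : ∀ z, ‖z‖ = r → HasDerivAt f (f' z) z) (hc : ContinuousOn f' (Metric.sphere 0 r)) :
    zc r n f' = (n+1) * zc r (n+1) f := by
  have hfc : ContinuousOn f (Metric.sphere 0 r) := fun z hz =>
    (hf z (by simpa using hz)).continuousAt.continuousWithinAt
  have h0 : (∮ z in C(0, r), ((z^(n+1))⁻¹ * f' z + (-((n:ℂ)+1)) * ((z^(n+1+1))⁻¹ * f z))) = 0 := by
    refine circleIntegral.integral_eq_zero_of_hasDerivWithinAt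
      (f := fun z => (z^(n+1))⁻¹ * f z) hr.le ?_
    intro z hz
    have hz1 : ‖z‖ = r := by simpa using hz
    have hz0 : z ≠ 0 := norm_pos_iff.1 (hz1 ▸ hr)
    have := ((hasDerivAt_pow (n+1) z).inv (pow_ne_zero _ hz0)).mul (hf z hz1)
    refine HasDerivAt.hasDerivWithinAt (this.congr_deriv ?_)
    simp only [Nat.add_sub_cancel, Pi.inv_apply]
    push_cast
    field_simp
    ring
  have i2 : CircleIntegrable (fun z => (-((n:ℂ)+1)) * ((z^(n+1+1))⁻¹ * f z)) 0 r := by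
    have := (zc_int hr (n+1) hfc).const_smul (a := -((n:ℂ)+1))
    exact this
  rw [circleIntegral.integral_add (zc_int hr n hc) i2, circleIntegral.integral_const_mul] at h0
  unfold zc
  linear_combination (2 * Real.pi * Complex.I : ℂ)⁻¹ * h0

noncomputable def zGf (t : ℝ) (z : ℂ) : ℂ :=
  ((1 + z)^2)⁻¹ * (1 - z)⁻¹ * Complex.exp (z * t / (1 + z))

lemma zcontour (r t : ℝ) (hr : 0 < r) (hr1 : r < 1) :
    ∃ d e : ℕ → ℂ, d 0 = 1 ∧ e 0 = 1 ∧ (∀ j, e (j+1) + e j = d (j+1)) ∧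
    (∀ j : ℕ, ((j:ℂ)+1) * (d (j+1) + d j) = (t:ℂ) * e j) ∧
    ∀ n, ∑ j ∈ Finset.range (n+1), e j = zc r n (zGf t) := by
  have hp : ∀ z : ℂ, ‖z‖ ≤ r → 1 + z ≠ 0 := by
    intro z hz h
    have : z = -1 := by linear_combination h
    rw [this] at hz; simp at hz; linarith
  have hm : ∀ z : ℂ, ‖z‖ ≤ r → 1 - z ≠ 0 := by
    intro z hz h
    have : z = 1 := by linear_combination -h
    rw [this] at hz; simp at hz; linarith
  set F : ℂ → ℂ := fun z => Complex.exp (z * t / (1 + z)) with hF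
  set D : ℂ → ℂ := fun z => (1+z)⁻¹ * F z with hD
  set E : ℂ → ℂ := fun z => ((1+z)^2)⁻¹ * F z with hE
  have dF : DifferentiableOn ℂ F (Metric.closedBall 0 r) := by
    intro z hz
    have h := hp z (by simpa using hz)
    exact (DifferentiableAt.cexp (by fun_prop (disch := assumption))).differentiableWithinAt
  have dI : DifferentiableOn ℂ (fun z : ℂ => (1+z)⁻¹) (Metric.closedBall 0 r) := by
    intro z hz
    have h := hp z (by simpa using hz)
    exact DifferentiableAt.differentiableWithinAt (by fun_prop (disch := assumption))
  have dI2 : DifferentiableOn ℂ (fun z : ℂ => ((1+z)^2)⁻¹) (Metric.closedBall 0 r) := by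
    intro z hz
    have h := pow_ne_zero 2 (hp z (by simpa using hz))
    exact DifferentiableAt.differentiableWithinAt (by fun_prop (disch := assumption))
  have dI3 : DifferentiableOn ℂ (fun z : ℂ => (1-z)⁻¹) (Metric.closedBall 0 r) := by
    intro z hz
    have h := hm z (by simpa using hz)
    exact DifferentiableAt.differentiableWithinAt (by fun_prop (disch := assumption))
  have dD : DifferentiableOn ℂ D (Metric.closedBall 0 r) := dI.mul dF
  have dE : DifferentiableOn ℂ E (Metric.closedBall 0 r) := dI2.mul dF
  have dG : DifferentiableOn ℂ (zGf t) (Metric.closedBall 0 r) := (dI2.mul dI3).mul dF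
  have cs : ∀ {f : ℂ → ℂ}, DifferentiableOn ℂ f (Metric.closedBall 0 r) →
      ContinuousOn f (Metric.sphere 0 r) := fun h =>
    h.continuousOn.mono Metric.sphere_subset_closedBall
  have czm : ∀ {f : ℂ → ℂ}, ContinuousOn f (Metric.sphere 0 r) →
      ContinuousOn (fun z => z * f z) (Metric.sphere 0 r) := fun h => continuousOn_id.mul h
  refine ⟨fun j => zc r j D, fun j => zc r j E, ?_, ?_, ?_, ?_, ?_⟩
  · simp only [zc_zero hr dD]; simp [hD, hF]
  · simp only [zc_zero hr dE]; simp [hE, hF]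
  · intro j
    simp only
    rw [← zc_shift hr j E, ← zc_add hr (j+1) (cs dE) (czm (cs dE))]
    refine zc_congr hr _ fun z hz => ?_
    have h := hp z hz.le
    simp only [hE, hD]; field_simp
  · intro j
    simp only
    rw [← zc_shift hr j D, ← zc_add hr (j+1) (cs dD) (czm (cs dD)), ← zc_const_mul r j (t:ℂ) E]
    rw [zc_congr (g := F) hr (j+1), ← zc_deriv hr j]
    · intro z hz
      have h := hp z hz.le
      have h3 : HasDerivAt (fun z : ℂ => 1 + z) 1 z := by
        simpa using (hasDerivAt_id z).const_add 1
      have := ((((hasDerivAt_id z).mul_const (t:ℂ)).div h3 h)).cexp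
      refine this.congr_deriv ?_
      simp only [hE, hF, id, Pi.div_apply]
      field_simp
      ring
    · exact continuousOn_const.mul (cs dE)
    · intro z hz
      have h := hp z hz.le
      simp only [hD]; field_simp
  · intro n
    induction n with
    | zero =>
      simp only [zero_add, Finset.sum_range_one]
      rw [zc_zero hr dE, zc_zero hr dG]; simp [hE, hF, zGf]
    | succ n ih =>
      rw [Finset.sum_range_succ, ih, ← zc_shift hr n, ← zc_add hr (n+1) (czm (cs dG)) (cs dE)]
      refine zc_congr hr _ fun z hz => ?_
      have h := hp z hz.le
      have h' := hm z hz.le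
      simp only [hE, hF, zGf]; field_simp; ring

noncomputable def zK0 (a M c s : ℝ) : ℂ :=
  8 * a * Complex.exp (-4 * (a * (1 + s * Complex.I))) *
    ((1 + Complex.exp (-2 * (a * (1 + s * Complex.I))))^2)⁻¹ *
    (1 - Complex.exp (-2 * (a * (1 + s * Complex.I))))⁻¹ *
    Complex.exp (M * (a * (1 + s * Complex.I) -
      c * ((1 - Complex.exp (-2 * (a * (1 + s * Complex.I)))) /
        (1 + Complex.exp (-2 * (a * (1 + s * Complex.I)))))))

noncomputable def zkap (a : ℝ) : ℝ := (1 - Real.exp (-2*a)) / (1 + Real.exp (-2*a))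

set_option maxHeartbeats 1000000 in
lemma zbound (a M c s : ℝ) (ha : 0 < a) (ha4 : a ≤ 1/4) (hM : M * a^3 = 1) (hMa : 4 ≤ M * a)
    (hc : 1 ≤ c) (hs : |s| ≤ Real.pi / (2 * a)) (hk : M * (a - zkap a) ≤ 1) :
    ‖zK0 a M c s‖ ≤ 8 * Real.exp 1 * Real.exp (-((c-1) * (M * a / 2))) * Real.exp (-(1/20) * s^2) := by
  set z := Complex.exp (-2 * (a * (1 + s * Complex.I))) with hz
  set r := Real.exp (-2*a) with hr
  have hM0 : 0 < M := by
    by_contra h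
    push Not at h
    have := mul_nonpos_of_nonpos_of_nonneg h ha.le
    linarith
  have hr0 : 0 < r := Real.exp_pos _
  have hr1 : r ≤ 1 - a := by
    have h1 : 2*a + 1 ≤ Real.exp (2*a) := Real.add_one_le_exp _
    have h2 : r * Real.exp (2*a) = 1 := by rw [hr, ← Real.exp_add]; simp
    nlinarith
  have hr2 : 1/2 ≤ r := by
    have := Real.add_one_le_exp (-2*a)
    linarith
  set S := (Real.sin (a*s))^2 with hS
  have hS0 : 0 ≤ S := sq_nonneg _
  have hS1 : S ≤ 1 := Real.sin_sq_le_one _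
  have hzre : z.re = r * (1 - 2*S) := by
    rw [hz, Complex.exp_re]
    have e1 : (-2 * ((a:ℂ) * (1 + s * Complex.I))).re = -2*a := by simp
    have e2 : (-2 * ((a:ℂ) * (1 + s * Complex.I))).im = -(2*(a*s)) := by simp
    rw [e1, e2, Real.cos_neg, Real.cos_two_mul, Real.cos_sq']
    rw [hS]; ring
  have hnz : ‖z‖ = r := by
    rw [hz, Complex.norm_exp, hr]; congr 1; simp
  have hnsq : z.re * z.re + z.im * z.im = r^2 := by
    rw [← Complex.normSq_apply, Complex.normSq_eq_norm_sq, hnz]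
  set V := Complex.normSq (1+z) with hV
  have hVe : V = (1+r)^2 - 4*r*S := by
    rw [hV, Complex.normSq_apply]
    simp only [Complex.add_re, Complex.one_re, Complex.add_im, Complex.one_im, zero_add]
    linear_combination hnsq + 2 * hzre
  have hVpos : 0 < V := by
    rw [hVe]; nlinarith
  set Y := (1+r)^2 / V with hY
  have hY1 : r * S ≤ Y - 1 := by
    have : Y - 1 = 4*r*S / V := by rw [hY]; field_simp; rw [hVe]; ring
    rw [this, le_div_iff₀ hVpos]
    have : V ≤ 4 := by rw [hVe]; nlinarith [mul_nonneg hr0.le hS0]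
    nlinarith [mul_nonneg hr0.le hS0]
  have hYge : 0 ≤ Y - 1 := le_trans (mul_nonneg hr0.le hS0) hY1
  have hkap : zkap a = (1-r)/(1+r) := rfl
  have hkge : a/2 ≤ zkap a := by
    rw [hkap, le_div_iff₀ (by linarith)]; nlinarith
  have hwre : ((1-z)/(1+z)).re = zkap a * Y := by
    rw [Complex.div_re, ← hV, hkap, hY]
    simp only [Complex.sub_re, Complex.add_re, Complex.one_re, Complex.sub_im, Complex.add_im,
      Complex.one_im]
    have : 1 + r ≠ 0 := by linarith
    field_simp
    linear_combination -hnsq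
  have hsin : (1/5) * (a^2 * s^2) ≤ r * S := by
    have h1 : |a*s| ≤ Real.pi/2 := by
      rw [abs_mul, abs_of_pos ha]
      calc a * |s| ≤ a * (Real.pi / (2*a)) := by gcongr
        _ = Real.pi/2 := by field_simp
    have h2 := Real.mul_abs_le_abs_sin h1
    have h3 : (2/Real.pi * |a*s|)^2 ≤ S := by
      rw [hS, ← sq_abs (Real.sin (a*s))]
      gcongr
    rw [mul_pow, sq_abs, mul_pow] at h3
    have hpi : (2/5) ≤ (2/Real.pi)^2 := by
      rw [div_pow, le_div_iff₀ (by positivity)]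
      have hp2 : Real.pi * Real.pi ≤ 3.15 * 3.15 :=
        mul_self_le_mul_self Real.pi_pos.le Real.pi_lt_d2.le
      linarith [sq Real.pi]
    have h4 : (2/5) * (a^2*s^2) ≤ S := le_trans (by gcongr) h3
    have h5 := mul_le_mul_of_nonneg_right hr2 hS0
    linarith
  -- norms
  have n1 : ‖Complex.exp (-4 * (a * (1 + s * Complex.I)))‖ ≤ 1 := by
    rw [Complex.norm_exp]
    have : (-4 * ((a:ℂ) * (1 + s * Complex.I))).re = -4*a := by simp
    rw [this, Real.exp_le_one_iff]; linarith
  have n2 : ‖((1+z)^2)⁻¹‖ ≤ Real.exp (Y-1) := by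
    rw [norm_inv, norm_pow, ← Complex.normSq_eq_norm_sq, ← hV]
    have h1 : V⁻¹ ≤ Y := by
      rw [hY, inv_eq_one_div]; gcongr; nlinarith
    linarith [Real.add_one_le_exp (Y-1)]
  have n3 : ‖(1-z)⁻¹‖ ≤ a⁻¹ := by
    rw [norm_inv]
    gcongr
    have := norm_sub_norm_le (1:ℂ) z
    rw [hnz, norm_one] at this
    linarith
  have n4 : ‖Complex.exp (M * (a * (1 + s * Complex.I) - c * ((1 - z) / (1 + z))))‖ =
      Real.exp (M * (a - c * (zkap a * Y))) := by
    rw [Complex.norm_exp, ← hwre]; congr 1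
    simp
  unfold zK0
  rw [← hz, norm_mul, norm_mul, norm_mul, norm_mul, n4]
  have n0 : ‖(8 * a : ℂ)‖ = 8 * a := by
    rw [norm_mul, Complex.norm_real, Real.norm_of_nonneg ha.le]; simp
  rw [n0]
  calc _ ≤ 8 * a * 1 * Real.exp (Y-1) * a⁻¹ * Real.exp (M * (a - c * (zkap a * Y))) := by gcongr
    _ = 8 * (Real.exp (Y-1) * Real.exp (M * (a - c * (zkap a * Y)))) := by field_simp
    _ ≤ 8 * (Real.exp 1 * Real.exp (-((c-1) * (M * a / 2))) * Real.exp (-(1/20) * s^2)) := by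
        rw [← Real.exp_add, ← Real.exp_add, ← Real.exp_add]
        refine mul_le_mul_of_nonneg_left (Real.exp_le_exp.2 ?_) (by norm_num)
        set k := zkap a
        have q1 : M * a / 2 ≤ M * k := by
          have := mul_le_mul_of_nonneg_left hkge hM0.le
          linarith
        have q2 : (c-1) * (M*a/2) ≤ (c-1) * (M * k) :=
          mul_le_mul_of_nonneg_left q1 (by linarith)
        have q3 : 0 ≤ (c-1) * (M*k) * (Y-1) :=
          mul_nonneg (mul_nonneg (by linarith) (by linarith)) hYge
        have q4 : M * a / 4 * (Y-1) ≤ (M * k - 1) * (Y-1) :=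
          mul_le_mul_of_nonneg_right (by linarith) hYge
        have q5 : M * a / 4 * ((1/5) * (a^2 * s^2)) ≤ M * a / 4 * (Y-1) :=
          mul_le_mul_of_nonneg_left (le_trans hsin hY1) (by linarith)
        have q6 : M * a / 4 * ((1/5) * (a^2 * s^2)) = 1/20 * s^2 := by
          linear_combination (s^2/20) * hM
        have q7 : Y - 1 + M * (a - c * (k * Y)) = M*(a-k) - (c-1)*(M*k) - (c-1)*(M*k)*(Y-1) - (M*k-1)*(Y-1) := by ring
        rw [q7]
        linarith
    _ = _ := by ring

lemma zcube : Tendsto (fun ω : ℂ => (ω - (1 - Complex.exp (-2*ω)) / (1 + Complex.exp (-2*ω))) / ω^3)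
    (nhdsWithin 0 {0}ᶜ) (nhds (1/3)) := by
  set R : ℂ → ℂ := fun ω => Complex.exp (-2*ω) - (1 - 2*ω + 2*ω^2 - 4/3*ω^3) with hR
  have hRlim : Tendsto (fun ω => R ω / ω^3) (nhdsWithin 0 {0}ᶜ) (nhds 0) := by
    have hb : ∀ᶠ ω : ℂ in nhdsWithin 0 {0}ᶜ, ‖R ω / ω^3‖ ≤ 16 * ‖ω‖ := by
      have h1 : ∀ᶠ ω : ℂ in nhdsWithin 0 {0}ᶜ, ‖ω‖ < 1/2 := by
        refine nhdsWithin_le_nhds ?_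
        have := Metric.ball_mem_nhds (0:ℂ) (show (0:ℝ) < 1/2 by norm_num)
        filter_upwards [this] with ω hω
        simpa using hω
      filter_upwards [h1, self_mem_nhdsWithin] with ω hω h0
      have hpos : 0 < ‖ω‖ := norm_pos_iff.2 h0
      have hx : ‖(-2*ω)‖ = 2 * ‖ω‖ := by simp
      have := Complex.exp_bound (x := -2*ω) (by rw [hx]; linarith) (n := 4) (by norm_num)
      rw [hx] at this
      have e : Complex.exp (-2*ω) - ∑ m ∈ Finset.range 4, (-2*ω)^m / (m.factorial : ℂ) = R ω := by
        simp only [hR, Finset.sum_range_succ, Finset.sum_range_zero, Nat.factorial]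
        push_cast; ring
      rw [e] at this
      rw [norm_div, norm_pow, div_le_iff₀ (by positivity)]
      refine this.trans ?_
      norm_num [Nat.factorial]
      have : 0 ≤ ‖ω‖^4 := by positivity
      nlinarith
    refine squeeze_zero_norm' hb ?_
    have : Tendsto (fun ω : ℂ => 16 * ‖ω‖) (nhds 0) (nhds (16 * ‖(0:ℂ)‖)) :=
      (continuous_const.mul continuous_norm).tendsto 0
    simp only [norm_zero, mul_zero] at this
    exact this.mono_left nhdsWithin_le_nhds
  have hid : Tendsto (fun ω : ℂ => ω) (nhdsWithin 0 {0}ᶜ) (nhds 0) :=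
    tendsto_id.mono_left nhdsWithin_le_nhds
  have hexp : Tendsto (fun ω : ℂ => 1 + Complex.exp (-2*ω)) (nhdsWithin 0 {0}ᶜ) (nhds 2) := by
    have : Tendsto (fun ω : ℂ => 1 + Complex.exp (-2*ω)) (nhds 0) (nhds (1 + Complex.exp (-2*0))) :=
      Continuous.tendsto (by fun_prop) 0
    have e : (1 + Complex.exp (-2*0) : ℂ) = 2 := by simp; norm_num
    rw [e] at this
    exact this.mono_left nhdsWithin_le_nhds
  have hmain : Tendsto (fun ω : ℂ => (2/3 - 4/3 * ω + (ω+1) * (R ω / ω^3)) / (1 + Complex.exp (-2*ω)))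
      (nhdsWithin 0 {0}ᶜ) (nhds ((2/3 - 4/3 * 0 + (0+1) * 0) / 2)) := by
    refine Tendsto.div ?_ hexp (by norm_num)
    exact (tendsto_const_nhds.sub (hid.const_mul _)).add ((hid.add_const 1).mul hRlim)
  have e : ((2/3 - 4/3 * 0 + (0+1) * 0) / 2 : ℂ) = 1/3 := by norm_num
  rw [e] at hmain
  refine hmain.congr' ?_
  have hne : ∀ᶠ ω : ℂ in nhdsWithin 0 {0}ᶜ, 1 + Complex.exp (-2*ω) ≠ 0 :=
    hexp.eventually_ne (by norm_num)
  filter_upwards [hne, self_mem_nhdsWithin] with ω h1 h0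
  have h0' : ω ≠ 0 := h0
  simp only [hR]
  generalize Complex.exp (-2*ω) = w at h1 ⊢
  field_simp
  ring

lemma zslope : Tendsto (fun ω : ℂ => ω * (1 - Complex.exp (-2*ω))⁻¹) (nhdsWithin 0 {0}ᶜ) (nhds (1/2)) := by
  have h : HasDerivAt (fun ω : ℂ => 1 - Complex.exp (-2*ω)) 2 0 := by
    have := (((hasDerivAt_id (0:ℂ)).const_mul (-2)).cexp).const_sub 1
    refine this.congr_deriv ?_
    simp
  have h2 := h.tendsto_slope_zero.inv₀ (by norm_num)
  rw [show (1/2:ℂ) = 2⁻¹ by norm_num]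
  refine h2.congr fun ω => ?_
  simp [mul_comm]

noncomputable def za (N : ℕ) : ℝ := (2 * (N:ℝ)) ^ (-(1/3) : ℝ)

lemma za_pos {N : ℕ} (hN : 0 < N) : 0 < za N := by
  have : (0:ℝ) < N := by exact_mod_cast hN
  unfold za; positivity

lemma za_cube {N : ℕ} (hN : 0 < N) : (2 * (N:ℝ)) * (za N)^3 = 1 := by
  have : (0:ℝ) < N := by exact_mod_cast hN
  have h2 : (0:ℝ) < 2 * N := by positivity
  unfold za
  rw [← Real.rpow_natCast, ← Real.rpow_mul h2.le]
  norm_num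
  rw [Real.rpow_neg_one]
  field_simp

lemma za_tendsto : Tendsto za atTop (nhds 0) := by
  have h1 : Tendsto (fun N : ℕ => 2 * (N:ℝ)) atTop atTop :=
    tendsto_natCast_atTop_atTop.const_mul_atTop (by norm_num)
  exact (tendsto_rpow_neg_atTop (show (0:ℝ) < 1/3 by norm_num)).comp h1

lemma zNa_tendsto : Tendsto (fun N : ℕ => (2 * (N:ℝ)) * za N) atTop atTop := by
  have h1 : Tendsto (fun N : ℕ => 2 * (N:ℝ)) atTop atTop :=
    tendsto_natCast_atTop_atTop.const_mul_atTop (by norm_num)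
  have h2 := (tendsto_rpow_atTop (show (0:ℝ) < 2/3 by norm_num)).comp h1
  refine h2.congr' ?_
  filter_upwards [eventually_gt_atTop 0] with N hN
  have : (0:ℝ) < N := by exact_mod_cast hN
  have h2 : (0:ℝ) < 2 * N := by positivity
  simp only [Function.comp, za]
  conv_rhs => lhs; rw [← Real.rpow_one (2 * (N:ℝ))]
  rw [← Real.rpow_add h2]; norm_num

lemma zomega (s : ℝ) : Tendsto (fun N : ℕ => (za N : ℂ) * (1 + s * Complex.I)) atTop
    (nhdsWithin 0 {0}ᶜ) := by
  rw [tendsto_nhdsWithin_iff]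
  constructor
  · have h1 : Tendsto (fun N : ℕ => (za N : ℂ)) atTop (nhds ((0:ℝ):ℂ)) :=
      (Complex.continuous_ofReal.tendsto 0).comp za_tendsto
    have := h1.mul_const (1 + s * Complex.I)
    simpa using this
  · filter_upwards [eventually_gt_atTop 0] with N hN
    have h1 : (za N : ℂ) ≠ 0 := by exact_mod_cast (za_pos hN).ne'
    have h2 : (1 + s * Complex.I) ≠ 0 := by
      intro h
      have := congrArg Complex.re h
      simp at this
    exact mul_ne_zero h1 h2

lemma zexpo (s : ℝ) : Tendsto (fun N : ℕ => ((2 * (N:ℝ) : ℝ) : ℂ) * ((za N : ℂ) * (1 + s * Complex.I) -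
      (1 - Complex.exp (-2 * (za N * (1 + s * Complex.I)))) /
        (1 + Complex.exp (-2 * (za N * (1 + s * Complex.I)))))) atTop
    (nhds ((1 + s * Complex.I)^3/3)) := by
  have h := ((zcube.comp (zomega s)).const_mul ((1 + s * Complex.I)^3))
  rw [mul_one_div] at h
  refine h.congr' ?_
  filter_upwards [eventually_gt_atTop 0] with N hN
  simp only [Function.comp]
  have h1 : (za N : ℂ) ≠ 0 := by exact_mod_cast (za_pos hN).ne'
  have h2 : (1 + s * Complex.I) ≠ 0 := by
    intro h
    have := congrArg Complex.re h
    simp at this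
  have h3 : ((2 * (N:ℝ) : ℝ) : ℂ) = ((za N : ℂ)^3)⁻¹ := by
    have : 2 * (N:ℝ) = ((za N)^3)⁻¹ := by
      exact eq_inv_of_mul_eq_one_left (za_cube hN)
    rw [this]; push_cast; rfl
  rw [h3, mul_pow]
  generalize (za N : ℂ) * (1 + s * Complex.I) -
      (1 - Complex.exp (-2 * (za N * (1 + s * Complex.I)))) /
        (1 + Complex.exp (-2 * (za N * (1 + s * Complex.I)))) = Q
  field_simp

lemma zkap_ev : ∀ᶠ N : ℕ in atTop, (2 * (N:ℝ)) * (za N - zkap (za N)) ≤ 1 := by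
  have h := (Complex.continuous_re.tendsto _).comp (zexpo 0)
  have e : ((1 + ((0:ℝ):ℂ) * Complex.I)^3/3).re = 1/3 := by
    have : ((1 + ((0:ℝ):ℂ) * Complex.I)^3/3) = ((1/3 : ℝ) : ℂ) := by push_cast; simp
    rw [this, Complex.ofReal_re]
  rw [e] at h
  filter_upwards [h.eventually (gt_mem_nhds (show (1/3:ℝ) < 1 by norm_num))] with N hN
  refine le_of_eq_of_le ?_ hN.le
  simp only [Function.comp]
  have : ((2 * (N:ℝ) : ℝ) : ℂ) * ((za N : ℂ) * (1 + ((0:ℝ):ℂ) * Complex.I) -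
      (1 - Complex.exp (-2 * (za N * (1 + ((0:ℝ):ℂ) * Complex.I)))) /
        (1 + Complex.exp (-2 * (za N * (1 + ((0:ℝ):ℂ) * Complex.I))))) =
      ((2 * (N:ℝ) * (za N - zkap (za N)) : ℝ) : ℂ) := by
    unfold zkap; push_cast; simp
  rw [this, Complex.ofReal_re]

lemma zpt (s : ℝ) : Tendsto (fun N : ℕ => zK0 (za N) (2 * N) 1 s) atTop
    (nhds (Complex.exp ((1 + s * Complex.I)^3/3) / (1 + s * Complex.I))) := by
  have h2 : (1 + s * Complex.I) ≠ 0 := by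
    intro h
    have := congrArg Complex.re h
    simp at this
  have ho := (zomega s).mono_right nhdsWithin_le_nhds
  have t1 : Tendsto (fun N : ℕ => Complex.exp (-4 * (za N * (1 + s * Complex.I)))) atTop (nhds 1) := by
    have := (Continuous.tendsto (f := fun ω : ℂ => Complex.exp (-4 * ω)) (by fun_prop) 0).comp ho
    simp only [mul_zero, Complex.exp_zero] at this
    exact this
  have t2 : Tendsto (fun N : ℕ => ((1 + Complex.exp (-2 * (za N * (1 + s * Complex.I))))^2)⁻¹) atTop
      (nhds (1/4)) := by
    have := (Continuous.tendsto (f := fun ω : ℂ => (1 + Complex.exp (-2 * ω))^2) (by fun_prop) 0).comp ho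
    have e : (1 + Complex.exp (-2 * 0) : ℂ)^2 = 4 := by simp; norm_num
    simp only [e] at this
    have := this.inv₀ (by norm_num)
    rw [one_div]; exact this
  have t3 := zslope.comp (zomega s)
  have t4 := (zexpo s).cexp
  have := (((t1.mul t2).mul t3).const_mul (8 * (1 + s * Complex.I)⁻¹)).mul t4
  have e : 8 * (1 + s * Complex.I)⁻¹ * (1 * (1/4) * (1/2)) * Complex.exp ((1 + s * Complex.I)^3/3) =
    Complex.exp ((1 + s * Complex.I)^3/3) / (1 + s * Complex.I) := by field_simp; norm_num
  rw [e] at this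
  refine this.congr fun N => ?_
  unfold zK0
  simp only [Function.comp]
  push_cast
  rw [one_mul]
  generalize Complex.exp (2 * N * _) = Q
  field_simp

noncomputable def zlimf (c s : ℝ) : ℂ :=
  if c = 1 then Complex.exp ((1 + s * Complex.I)^3/3) / (1 + s * Complex.I) else 0

noncomputable def zI (N : ℕ) : Set ℝ := Set.Ioc (-(Real.pi / (2 * za N))) (Real.pi / (2 * za N))

lemma zDCT (c : ℝ) (hc : 1 ≤ c) : Tendsto (fun N : ℕ => ∫ s, (zI N).indicator (zK0 (za N) (2 * N) c) s) atTop
    (nhds (∫ s, zlimf c s)) := by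
  have hbd : ∀ᶠ N : ℕ in atTop, ∀ s, ‖(zI N).indicator (zK0 (za N) (2 * N) c) s‖ ≤
      8 * Real.exp 1 * Real.exp (-((c-1) * (2 * N * za N / 2))) * Real.exp (-(1/20) * s^2) := by
    filter_upwards [eventually_gt_atTop 0, zkap_ev, zNa_tendsto.eventually_ge_atTop 4,
      za_tendsto.eventually (ge_mem_nhds (show (0:ℝ) < 1/4 by norm_num))] with N hN hk h4 ha4 s
    by_cases hs : s ∈ zI N
    · rw [Set.indicator_of_mem hs]
      exact zbound _ _ _ _ (za_pos hN) ha4 (za_cube hN) h4 hc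
        (abs_le.2 ⟨hs.1.le, hs.2⟩) hk
    · rw [Set.indicator_of_notMem hs, norm_zero]; positivity
  refine tendsto_integral_filter_of_dominated_convergence
    (fun s => 8 * Real.exp 1 * Real.exp (-(1/20) * s^2)) ?_ ?_ ?_ ?_
  · refine Eventually.of_forall fun N => ?_
    refine (Measurable.indicator ?_ measurableSet_Ioc).aestronglyMeasurable
    unfold zK0
    fun_prop
  · filter_upwards [hbd, zNa_tendsto.eventually_ge_atTop 0] with N h h0
    refine Eventually.of_forall fun s => (h s).trans ?_
    have : Real.exp (-((c-1) * (2 * N * za N / 2))) ≤ 1 := by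
      rw [Real.exp_le_one_iff]
      have : 0 ≤ (c-1) * (2 * N * za N / 2) := mul_nonneg (by linarith) (by linarith)
      linarith
    calc _ ≤ 8 * Real.exp 1 * 1 * Real.exp (-(1/20) * s^2) := by gcongr
      _ = _ := by ring
  · exact (integrable_exp_neg_mul_sq (by norm_num)).const_mul _
  · refine Eventually.of_forall fun s => ?_
    by_cases hc1 : c = 1
    · subst hc1
      simp only [zlimf, if_true]
      refine (zpt s).congr' ?_
      have hlim : Tendsto (fun N : ℕ => |s| * (2 * za N)) atTop (nhds 0) := by
        simpa using (za_tendsto.const_mul 2).const_mul |s|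
      filter_upwards [eventually_gt_atTop 0, hlim.eventually (gt_mem_nhds Real.pi_pos)] with N hN h
      have hp := za_pos hN
      rw [Set.indicator_of_mem]
      have : |s| < Real.pi / (2 * za N) := by rw [lt_div_iff₀ (by positivity)]; exact h
      exact ⟨(abs_lt.1 this).1, (abs_lt.1 this).2.le⟩
    · simp only [zlimf, hc1, if_false]
      have hc2 : 0 < c - 1 := by
        have := lt_of_le_of_ne hc (Ne.symm hc1)
        linarith
      refine squeeze_zero_norm' (hbd.mono fun N h => h s) ?_
      have h1 : Tendsto (fun N : ℕ => Real.exp (-((c-1) * (2 * N * za N / 2)))) atTop (nhds 0) :=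
        Real.tendsto_exp_neg_atTop_nhds_zero.comp
          ((zNa_tendsto.atTop_div_const (by norm_num)).const_mul_atTop hc2)
      have h2 := (h1.const_mul (8 * Real.exp 1)).mul_const (Real.exp (-(1/20) * s^2))
      rw [mul_zero, zero_mul] at h2
      exact h2

lemma zline_ne (s : ℝ) : (1 + s * Complex.I) ≠ 0 := by
  intro h
  have := congrArg Complex.re h
  simp at this

lemma zAi_norm (u t : ℝ) : ‖Complex.exp ((1 + (t:ℂ)*Complex.I)^3/3 - u*(1 + (t:ℂ)*Complex.I))‖ =
    Real.exp (-u) * (Real.exp (1/3) * Real.exp (-1 * t^2)) := by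
  rw [Complex.norm_exp, ← Real.exp_add, ← Real.exp_add]
  congr 1
  have : (1 + (t:ℂ)*Complex.I)^3/3 - u*(1 + (t:ℂ)*Complex.I) =
      ((-u + (1/3 + -1*t^2) : ℝ) : ℂ) + ((t - t^3/3 - u*t : ℝ) : ℂ) * Complex.I := by
    push_cast
    have h2 := Complex.I_sq
    have h3 : Complex.I^3 = -Complex.I := by rw [pow_succ, h2]; ring
    ring_nf
    rw [h2, h3]; ring
  rw [this]
  simp [-Complex.ofReal_add, -Complex.ofReal_sub, -Complex.ofReal_mul, -Complex.ofReal_pow,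
    -Complex.ofReal_div, -Complex.ofReal_neg]

lemma zAi_int : Integrable (fun q : ℝ × ℝ =>
    Complex.exp ((1 + (q.2:ℂ)*Complex.I)^3/3 - q.1*(1 + (q.2:ℂ)*Complex.I)))
    ((volume.restrict (Set.Ioi (0:ℝ))).prod volume) := by
  have h1 : Integrable (fun u : ℝ => Real.exp (-u)) (volume.restrict (Set.Ioi (0:ℝ))) :=
    integrableOn_exp_neg_Ioi 0
  have h2 : Integrable (fun t : ℝ => Real.exp (1/3) * Real.exp (-1 * t^2)) :=
    (integrable_exp_neg_mul_sq (by norm_num)).const_mul _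
  refine (h1.mul_prod h2).mono' (Continuous.aestronglyMeasurable (by fun_prop)) ?_
  exact Eventually.of_forall fun q => (zAi_norm q.1 q.2).le

lemma zAiryC_int : Integrable (fun u : ℝ => AiryC u) (volume.restrict (Set.Ioi (0:ℝ))) := by
  unfold AiryC
  exact zAi_int.integral_prod_left.const_mul _

lemma zAiryR_int : IntegrableOn AiryR (Set.Ioi (0:ℝ)) := zAiryC_int.re

lemma zAi1_tendsto : Tendsto Ai1 atTop (nhds 0) := by
  have h := intervalIntegral_tendsto_integral_Ioi 0 zAiryR_int tendsto_id
  have h2 := h.const_sub (∫ u in Set.Ioi 0, AiryR u)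
  rw [sub_self] at h2
  refine h2.congr' ?_
  filter_upwards [eventually_ge_atTop 0] with ξ hξ
  unfold Ai1
  have := intervalIntegral.integral_interval_add_Ioi (a := (0:ℝ)) (b := ξ) (f := AiryR) zAiryR_int
    (zAiryR_int.mono_set (Set.Ioi_subset_Ioi hξ))
  simp only [id]
  linarith

lemma zAi1_zero_re : Ai1 0 = ((1 / (2 * (Real.pi : ℂ))) * ∫ s, zlimf 1 s).re := by
  have h1 : Ai1 0 = (∫ u in Set.Ioi (0:ℝ), AiryC u).re := by
    unfold Ai1 AiryR
    exact integral_re zAiryC_int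
  rw [h1]
  congr 1
  unfold AiryC
  rw [integral_const_mul]
  congr 1
  rw [integral_integral_swap zAi_int]
  refine integral_congr_ae (Eventually.of_forall fun t => ?_)
  simp only [zlimf, if_true]
  have e : ∀ u : ℝ, Complex.exp ((1 + (t:ℂ)*Complex.I)^3/3 - u*(1 + (t:ℂ)*Complex.I)) =
      Complex.exp ((1 + (t:ℂ)*Complex.I)^3/3) * Complex.exp (-(1 + (t:ℂ)*Complex.I) * u) := by
    intro u
    rw [← Complex.exp_add]; congr 1; ring
  simp only [e]
  rw [integral_const_mul, integral_exp_mul_complex_Ioi (by simp)]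
  have := zline_ne t
  simp only [Complex.ofReal_zero, mul_zero, Complex.exp_zero]
  rw [neg_div_neg_eq, mul_one_div]

lemma zlimf_real : (starRingEnd ℂ) (∫ s, zlimf 1 s) = ∫ s, zlimf 1 s := by
  rw [← integral_conj, ← integral_neg_eq_self]
  refine integral_congr_ae (Eventually.of_forall fun s => ?_)
  simp only [zlimf, if_true, map_div₀, ← Complex.exp_conj, map_pow, map_add, map_one, map_mul,
    Complex.conj_ofReal, Complex.conj_I, map_ofNat]
  push_cast
  rw [neg_mul_neg]

lemma zAi1_zero : ((Ai1 0 : ℝ) : ℂ) = (1 / (2 * (Real.pi : ℂ))) * ∫ s, zlimf 1 s := by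
  rw [zAi1_zero_re]
  rw [← Complex.conj_eq_iff_re]
  simp [zlimf_real]
  left; exact map_ofNat _ 2

lemma zrep (N : ℕ) (hN : 2 ≤ N) (c : ℝ) :
    4 * Complex.exp (-(2 * N * c)) * zc (Real.exp (-2 * za N)) (N-2) (zGf (4 * N * c)) =
      (1 / (2 * (Real.pi : ℂ))) * ∫ s, (zI N).indicator (zK0 (za N) (2 * N) c) s := by
  obtain ⟨n, rfl⟩ : ∃ n, N = n + 2 := ⟨N - 2, by omega⟩
  have ha := za_pos (show 0 < n + 2 by omega)
  set a := za (n+2) with hadef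
  set r := Real.exp (-2*a) with hr
  have hr0 : 0 < r := Real.exp_pos _
  set f := zGf (4 * (n+2:ℕ) * c) with hf
  set g : ℝ → ℂ := fun θ => ((circleMap 0 r θ)^n)⁻¹ * f (circleMap 0 r θ) with hg
  have s1 : zc r (n+2-2) f = (1 / (2 * (Real.pi : ℂ))) * ∫ θ in (0:ℝ)..(2*Real.pi), g θ := by
    have : (∮ z in C(0, r), (z^(n+1))⁻¹ * f z) = Complex.I * ∫ θ in (0:ℝ)..(2*Real.pi), g θ := by
      rw [circleIntegral, ← intervalIntegral.integral_const_mul]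
      congr 1
      funext θ
      have : circleMap 0 r θ ≠ 0 := by simpa using hr0.ne'
      rw [deriv_circleMap, smul_eq_mul, hg]
      field_simp
      ring
    unfold zc
    rw [Nat.add_sub_cancel, this]
    have := Complex.I_ne_zero
    have : (Real.pi : ℂ) ≠ 0 := by exact_mod_cast Real.pi_ne_zero
    field_simp
  have s2 : (∫ θ in (0:ℝ)..(2*Real.pi), g θ) = ∫ θ in (-Real.pi)..Real.pi, g θ := by
    have hp : Function.Periodic g (2*Real.pi) := by
      intro θ
      simp only [hg, periodic_circleMap 0 r θ]
    have := hp.intervalIntegral_add_eq 0 (-Real.pi)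
    rw [zero_add, show -Real.pi + 2*Real.pi = Real.pi by ring] at this
    exact this
  have s3 : (∫ θ in (-Real.pi)..Real.pi, g θ) =
      2 * a * ∫ s in (-(Real.pi/(2*a)))..(Real.pi/(2*a)), g ((-2*a) * s) := by
    rw [intervalIntegral.integral_comp_mul_left _ (by linarith : -2*a ≠ 0)]
    rw [show -2*a * -(Real.pi/(2*a)) = Real.pi by field_simp,
      show -2*a * (Real.pi/(2*a)) = -Real.pi by field_simp,
      intervalIntegral.integral_symm (-Real.pi) Real.pi, Complex.real_smul]
    have : (a:ℂ) ≠ 0 := by exact_mod_cast ha.ne'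
    push_cast
    field_simp
  have hle : -(Real.pi/(2*a)) ≤ Real.pi/(2*a) := by
    have : 0 < Real.pi/(2*a) := by positivity
    linarith
  rw [s1, s2, s3, intervalIntegral.integral_of_le hle]
  unfold zI
  rw [integral_indicator measurableSet_Ioc, ← hadef, mul_left_comm]
  congr 1
  rw [← mul_assoc, ← integral_const_mul]
  congr 1
  funext s
  have hz : circleMap 0 r (-2*a*s) = Complex.exp (-2 * (a * (1 + s * Complex.I))) := by
    rw [circleMap, hr, zero_add]; push_cast
    rw [← Complex.exp_add]; congr 1; ring
  simp only [hg, hz, hf, zGf, zK0]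
  set ω : ℂ := a * (1 + s * Complex.I) with hω
  have hnz : ‖Complex.exp (-2*ω)‖ < 1 := by
    rw [Complex.norm_exp, Real.exp_lt_one_iff, hω]; simp [ha]
  have hp : 1 + Complex.exp (-2*ω) ≠ 0 := by
    intro h
    have : Complex.exp (-2*ω) = -1 := by linear_combination h
    rw [this] at hnz; simp at hnz
  have e1 : (Complex.exp (-2*ω)^n)⁻¹ = Complex.exp (2*n*ω) := by
    rw [← Complex.exp_nat_mul, ← Complex.exp_neg]; congr 1; ring
  rw [e1]
  have e2 : Complex.exp (-(2 * (n+2:ℕ) * c)) * Complex.exp (2*n*ω) *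
      Complex.exp (Complex.exp (-2*ω) * ((4 * (n+2:ℕ) * c : ℝ):ℂ) / (1 + Complex.exp (-2*ω))) =
      Complex.exp (-4*ω) * Complex.exp (((2 * (n+2:ℕ) : ℝ):ℂ) * (ω - c * ((1 - Complex.exp (-2*ω)) /
        (1 + Complex.exp (-2*ω))))) := by
    rw [← Complex.exp_add, ← Complex.exp_add, ← Complex.exp_add]
    congr 1
    generalize Complex.exp (-2*ω) = w at hp ⊢
    push_cast
    field_simp
    ring
  linear_combination (8 * a * ((1 + Complex.exp (-2*ω))^2)⁻¹ * (1 - Complex.exp (-2*ω))⁻¹) * e2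

/-- Pointwise asymptotics of `σ_{H_N}` in the classically forbidden region
`x² + p² ≥ 2μ`: the difference with `p·χ_D^{(N)}` tends to zero. -/
theorem pointwise_forbidden_sigmaH (μ : ℝ) (hμ : 0 < μ) (x p : ℝ)
    (hxp : 2 * μ ≤ x ^ 2 + p ^ 2) :
    Tendsto (fun N : ℕ => sigmaH (μ / N) N x p - (p : ℂ) * ((chiDN μ N x p : ℝ) : ℂ))
      atTop (nhds 0) := by
  set c := (x^2+p^2)/(2*μ) with hcdef
  have hc : 1 ≤ c := by rw [hcdef, le_div_iff₀ (by positivity)]; linarith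
  have hsig : ∀ᶠ N : ℕ in atTop, (p:ℂ) * ((1 / (2 * (Real.pi : ℂ))) *
      ∫ s, (zI N).indicator (zK0 (za N) (2 * N) c) s) = sigmaH (μ / N) N x p := by
    filter_upwards [eventually_ge_atTop 2] with N hN
    have hN0 : (0:ℝ) < N := by
      have : 0 < N := by omega
      exact_mod_cast this
    have ha := za_pos (show 0 < N by omega)
    obtain ⟨d, e, hd0, he0, h1, h2, h3⟩ := zcontour (Real.exp (-2 * za N)) (4 * N * c)
      (Real.exp_pos _) (by rw [Real.exp_lt_one_iff]; linarith)
    rw [← zrep N hN c, ← h3 (N-2), show N - 2 + 1 = N - 1 by omega]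
    have hq : (x^2+p^2)/(μ/N) = 2 * N * c := by rw [hcdef]; field_simp
    rw [zsigma (μ/N) (by positivity) N x p d e hd0 he0 h1 (by
      intro j
      rw [h2 j, mul_div_assoc, hq]
      push_cast; ring), ← Finset.sum_mul, hq]
    push_cast
    ring
  have hlim : Tendsto (fun N : ℕ => sigmaH (μ / N) N x p) atTop
      (nhds (p * ((1 / (2 * (Real.pi : ℂ))) * ∫ s, zlimf c s))) :=
    (((zDCT c hc).const_mul _).const_mul _).congr' hsig
  have hchi : Tendsto (fun N : ℕ => ((chiDN μ N x p : ℝ) : ℂ)) atTop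
      (nhds ((1 / (2 * (Real.pi : ℂ))) * ∫ s, zlimf c s)) := by
    by_cases hc1 : c = 1
    · have h0 : x^2 + p^2 - 2*μ = 0 := by
        rw [hcdef, div_eq_one_iff_eq (by positivity)] at hc1
        linarith
      rw [hc1, ← zAi1_zero]
      simp only [chiDN, h0, mul_zero, zero_div]
      exact tendsto_const_nhds
    · have hc2 : 0 < c - 1 := by
        have := lt_of_le_of_ne hc (Ne.symm hc1)
        linarith
      have hz : (∫ s, zlimf c s) = 0 := by simp [zlimf, hc1]
      rw [hz, mul_zero]
      have h1 : Tendsto (fun N : ℕ => 2 * (N:ℝ)) atTop atTop :=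
        tendsto_natCast_atTop_atTop.const_mul_atTop (by norm_num)
      have h2 := ((tendsto_rpow_atTop (show (0:ℝ) < 2/3 by norm_num)).comp h1).atTop_mul_const hc2
      have h3 := (Complex.continuous_ofReal.tendsto 0).comp (zAi1_tendsto.comp h2)
      rw [Complex.ofReal_zero] at h3
      refine h3.congr fun N => ?_
      simp only [Function.comp, chiDN]
      congr 2
      rw [hcdef]; field_simp
  have := hlim.sub (hchi.const_mul (p:ℂ))
  rwa [sub_self] at this
end
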